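/- arXiv:1603.07377 — 2 statements merged into one kernel-verified Lean document; each statement's English description precedes it below -/
import Mathlib

section
/- For any λ > 0, δ > 0, σ_w > 0, any q ∈ [1,2], and any random variable B with E[B²] < ∞ independent of Z ~ N(0,1), there exists a unique pair (σ̄, χ̄) with σ̄ > 0 and χ̄ ≥ 0 satisfying both σ̄² = σ_w² + (1/δ)·E[(η_q(B + σ̄Z; χ̄ σ̄^{2−q}) − B)²] and λ = χ̄ σ̄^{2−q} · (1 − (1/δ)·E[∂₁η_q(B + σ̄Z; χ̄ σ̄^{2−q})]), where ∂₁η_q denotes the (for q = 1, almost-everywhere) derivative of η_q with respect to its first argument. -/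
open MeasureTheory ProbabilityTheory Real Filter Set

noncomputable section

/-- The standard Gaussian measure on `ℝ`. -/
def stdGaussian : Measure ℝ := gaussianReal 0 1

/-- `IsProx q χ u v` : `v` minimizes `z ↦ (1/2)(u−z)² + χ|z|^q`,
i.e. `v = η_q(u;χ)` is the proximal operator of `χ|·|^q` at `u`. -/
def IsProx (q χ u v : ℝ) : Prop :=
  ∀ z : ℝ, (1/2) * (u - v)^2 + χ * |v| ^ q ≤ (1/2) * (u - z)^2 + χ * |z| ^ q

/-- First-order (variational) characterization of the proximal operator of `χ|·|^q`. -/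
theorem IsProx.variational {q χ u v : ℝ} (hq : 1 ≤ q) (hχ : 0 ≤ χ) (h : IsProx q χ u v) (z : ℝ) :
    (u - v) * (z - v) ≤ χ * (|z| ^ q - |v| ^ q) := by
  have key : ∀ t : ℝ, 0 < t → t ≤ 1 →
      (u - v) * (z - v) - χ * (|z| ^ q - |v| ^ q) ≤ t * ((z - v) ^ 2 / 2) := by
    intro t ht ht1
    have hconv : |v + t * (z - v)| ^ q ≤ (1 - t) * |v| ^ q + t * |z| ^ q := by
      have habs : |v + t * (z - v)| ≤ (1 - t) * |v| + t * |z| := by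
        have e : v + t * (z - v) = (1 - t) * v + t * z := by ring
        rw [e]
        refine (abs_add_le _ _).trans ?_
        rw [abs_mul, abs_mul, abs_of_nonneg (by linarith : (0 : ℝ) ≤ 1 - t), abs_of_pos ht]
      refine (Real.rpow_le_rpow (abs_nonneg _) habs (by linarith)).trans ?_
      have := (convexOn_rpow hq).2 (x := |v|) (y := |z|) (abs_nonneg v) (abs_nonneg z)
        (by linarith : (0 : ℝ) ≤ 1 - t) ht.le (by ring)
      simpa using this
    have h1 := h (v + t * (z - v))
    have h2 := mul_le_mul_of_nonneg_left hconv hχ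
    have h3 : t * ((u - v) * (z - v) - χ * (|z| ^ q - |v| ^ q)) ≤ t * (t * ((z - v) ^ 2 / 2)) := by
      nlinarith
    exact le_of_mul_le_mul_left h3 ht
  by_contra! hcon
  set A := (u - v) * (z - v) - χ * (|z| ^ q - |v| ^ q) with hA
  have hApos : 0 < A := by linarith
  set D := (z - v) ^ 2 / 2 with hD
  have hD0 : 0 ≤ D := by positivity
  have hD1 : 0 < D := lt_of_lt_of_le hApos (by simpa using key 1 one_pos le_rfl)
  have h1 := key 1 one_pos le_rfl
  have h2 := key (A / (2 * D)) (by positivity) (by rw [div_le_one (by positivity)]; linarith)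
  have h3 : A / (2 * D) * D = A / 2 := by field_simp
  linarith

/-- Monotonicity of the (rescaled) subgradients selected by two proximal maps. -/
theorem IsProx.monotone_subgradient {q χ₁ χ₂ u₁ u₂ v₁ v₂ : ℝ} (hq : 1 ≤ q) (hχ₁ : 0 < χ₁)
    (hχ₂ : 0 < χ₂) (h₁ : IsProx q χ₁ u₁ v₁) (h₂ : IsProx q χ₂ u₂ v₂) :
    0 ≤ ((u₁ - v₁) / χ₁ - (u₂ - v₂) / χ₂) * (v₁ - v₂) := by
  have e₁ : (u₁ - v₁) / χ₁ * (v₂ - v₁) ≤ |v₂| ^ q - |v₁| ^ q := by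
    rw [div_mul_eq_mul_div, div_le_iff₀ hχ₁, mul_comm (_ - _) χ₁]
    exact h₁.variational hq hχ₁.le v₂
  have e₂ : (u₂ - v₂) / χ₂ * (v₁ - v₂) ≤ |v₁| ^ q - |v₂| ^ q := by
    rw [div_mul_eq_mul_div, div_le_iff₀ hχ₂, mul_comm (_ - _) χ₂]
    exact h₂.variational hq hχ₂.le v₁
  linarith

theorem IsProx.mul_abs_rpow_le {q χ u v : ℝ} (hq : 1 ≤ q) (hχ : 0 ≤ χ) (h : IsProx q χ u v) :
    χ * |v| ^ q ≤ (u - v) * v := by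
  have := h.variational hq hχ 0
  rw [abs_zero, Real.zero_rpow (by linarith)] at this
  linarith

theorem IsProx.abs_le {q χ u v : ℝ} (hq : 1 ≤ q) (hχ : 0 ≤ χ) (h : IsProx q χ u v) :
    |v| ≤ |u| := by
  have h1 := h.mul_abs_rpow_le hq hχ
  have h2 : 0 ≤ χ * |v| ^ q := by positivity
  have h3 : |v| * |v| ≤ |u| * |v| := by
    rw [← abs_mul u v, abs_mul_abs_self]
    have := le_abs_self (u * v)
    nlinarith
  rcases (abs_nonneg v).eq_or_lt with h0 | h0
  · rw [← h0]; exact abs_nonneg u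
  · exact le_of_mul_le_mul_right h3 h0

/-- A quantitative joint continuity estimate for the proximal operator. -/
theorem IsProx.abs_sub_le {q χ₁ χ₂ u₁ u₂ v₁ v₂ : ℝ} (hq : 1 ≤ q) (hχ₁ : 0 < χ₁)
    (hχ₂ : 0 < χ₂) (h₁ : IsProx q χ₁ u₁ v₁) (h₂ : IsProx q χ₂ u₂ v₂) :
    |v₁ - v₂| ≤ |u₁ - v₂ - χ₁ / χ₂ * (u₂ - v₂)| := by
  have h := h₁.monotone_subgradient hq hχ₁ hχ₂ h₂
  set d := u₁ - v₂ - χ₁ / χ₂ * (u₂ - v₂) with hd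
  have e : ((u₁ - v₁) / χ₁ - (u₂ - v₂) / χ₂) * (v₁ - v₂)
      = (d * (v₁ - v₂) - (v₁ - v₂) ^ 2) / χ₁ := by
    rw [hd]; field_simp; ring
  rw [e] at h
  have h' : (v₁ - v₂) ^ 2 ≤ d * (v₁ - v₂) := by
    have := (div_nonneg_iff.1 h)
    rcases this with ⟨a, _⟩ | ⟨_, b⟩ <;> linarith
  have h3 : |v₁ - v₂| * |v₁ - v₂| ≤ |d| * |v₁ - v₂| := by
    rw [← abs_mul d, abs_mul_abs_self]
    have := le_abs_self (d * (v₁ - v₂))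
    nlinarith
  rcases (abs_nonneg (v₁ - v₂)).eq_or_lt with h0 | h0
  · rw [← h0]; exact abs_nonneg _
  · exact le_of_mul_le_mul_right h3 h0

theorem IsProx.lipschitzWith {q χ : ℝ} {f : ℝ → ℝ} (hq : 1 ≤ q) (hχ : 0 < χ)
    (h : ∀ u, IsProx q χ u (f u)) : LipschitzWith 1 f := by
  refine LipschitzWith.of_dist_le_mul fun x y => ?_
  have := (h x).abs_sub_le hq hχ hχ (h y)
  rw [div_self hχ.ne'] at this
  simpa [Real.dist_eq] using this

/-- The proximal operator is jointly continuous in its argument and its (positive) parameter. -/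
theorem IsProx.continuousAt {q : ℝ} {η : ℝ → ℝ → ℝ} (hq : 1 ≤ q)
    (hη : ∀ u χ, 0 ≤ χ → IsProx q χ u (η u χ)) {u χ : ℝ} (hχ : 0 < χ) :
    ContinuousAt (fun p : ℝ × ℝ => η p.1 p.2) (u, χ) := by
  rw [ContinuousAt, tendsto_iff_dist_tendsto_zero]
  have hlim : Tendsto (fun p : ℝ × ℝ => |p.1 - η u χ - p.2 / χ * (u - η u χ)|) (nhds (u, χ))
      (nhds 0) := by
    have hc : Continuous (fun p : ℝ × ℝ => |p.1 - η u χ - p.2 / χ * (u - η u χ)|) := by fun_prop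
    have := hc.tendsto (u, χ)
    simpa [div_self hχ.ne'] using this
  refine squeeze_zero' (Eventually.of_forall fun _ => dist_nonneg) ?_ hlim
  have hpos : ∀ᶠ p : ℝ × ℝ in nhds (u, χ), 0 < p.2 :=
    (continuous_snd.tendsto (u, χ)).eventually (lt_mem_nhds hχ)
  filter_upwards [hpos] with p hp
  rw [Real.dist_eq]
  exact (hη p.1 p.2 hp.le).abs_sub_le hq hp hχ (hη u χ hχ.le)

theorem IsProx.eq_zero_of_abs_lt {χ u v : ℝ} (h : IsProx 1 χ u v) (hu : |u| < χ) : v = 0 := by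
  have h1 := h.mul_abs_rpow_le le_rfl ((abs_nonneg u).trans hu.le)
  rw [Real.rpow_one] at h1
  have h2 : u * v ≤ |u| * |v| := by rw [← abs_mul]; exact le_abs_self _
  nlinarith [mul_nonneg (sub_nonneg.2 hu.le) (abs_nonneg v), sq_nonneg v]

theorem IsProx.eq_sub_of_lt {χ u v : ℝ} (h : IsProx 1 χ u v) (hχ : 0 ≤ χ) (hu : χ < u) :
    v = u - χ := by
  have h1 := h.variational le_rfl hχ (u - χ)
  rw [Real.rpow_one, Real.rpow_one, abs_of_pos (sub_pos.2 hu)] at h1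
  have h2 := mul_le_mul_of_nonneg_left (le_abs_self v) hχ
  nlinarith [sq_nonneg (u - χ - v)]

theorem IsProx.neg {q χ u v : ℝ} (h : IsProx q χ u v) : IsProx q χ (-u) (-v) := by
  intro z
  have := h (-z)
  rw [abs_neg] at this ⊢
  convert this using 2 <;> ring

/-- Away from the two kinks, the soft-thresholding operator has the expected derivative. -/
theorem IsProx.hasDerivAt_soft {χ u : ℝ} {f : ℝ → ℝ} (hχ : 0 < χ) (h : ∀ u, IsProx 1 χ u (f u))
    (hu : |u| ≠ χ) : HasDerivAt f (if χ < |u| then 1 else 0) u := by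
  rcases lt_or_gt_of_ne hu with hlt | hgt
  · rw [if_neg hlt.not_gt]
    refine (hasDerivAt_const u (0 : ℝ)).congr_of_eventuallyEq ?_
    filter_upwards [(continuous_abs.tendsto u).eventually (gt_mem_nhds hlt)] with x hx
    exact (h x).eq_zero_of_abs_lt hx
  · rw [if_pos hgt]
    rcases lt_abs.1 hgt with hp | hn
    · refine ((hasDerivAt_id u).sub_const χ).congr_of_eventuallyEq ?_
      filter_upwards [lt_mem_nhds hp] with x hx
      exact (h x).eq_sub_of_lt hχ.le hx
    · refine ((hasDerivAt_id u).add_const χ).congr_of_eventuallyEq ?_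
      filter_upwards [gt_mem_nhds (lt_neg.1 hn)] with x hx
      have := (h x).neg.eq_sub_of_lt hχ.le (lt_neg.1 hx)
      simp only [id]
      linarith

theorem stdGaussian_integral_eq (f : ℝ → ℝ) :
    ∫ z, f z ∂stdGaussian = ∫ z, gaussianPDFReal 0 1 z * f z := by
  rw [_root_.stdGaussian, integral_gaussianReal_eq_integral_smul one_ne_zero]
  rfl

theorem integrable_stdGaussian_iff (f : ℝ → ℝ) :
    Integrable f stdGaussian ↔ Integrable (fun z => gaussianPDFReal 0 1 z * f z) := by
  rw [_root_.stdGaussian, gaussianReal_of_var_ne_zero 0 one_ne_zero,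
    integrable_withDensity_iff_integrable_smul' (measurable_gaussianPDF 0 1)
      (ae_of_all _ fun _ => gaussianPDF_lt_top)]
  simp [toReal_gaussianPDF]

instance : IsProbabilityMeasure stdGaussian :=
  inferInstanceAs (IsProbabilityMeasure (gaussianReal 0 1))

theorem hasDerivAt_gaussianPDFReal_std (x : ℝ) :
    HasDerivAt (gaussianPDFReal 0 1) (-(x * gaussianPDFReal 0 1 x)) x := by
  have h : HasDerivAt (fun y : ℝ => -(y - 0) ^ 2 / (2 * ((1 : NNReal) : ℝ))) (-x) x := by
    have := (((hasDerivAt_id x).sub_const 0).pow 2).neg.div_const (2 * ((1 : NNReal) : ℝ))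
    refine this.congr_deriv ?_
    simp only [id, NNReal.coe_one]
    norm_num
    ring
  have h2 := h.exp.const_mul (√(2 * π * ((1 : NNReal) : ℝ)))⁻¹
  rw [gaussianPDFReal_def]
  exact h2.congr_deriv (by ring)

theorem LipschitzWith.abs_le_add {K : NNReal} {f : ℝ → ℝ} (hf : LipschitzWith K f) (x : ℝ) :
    |f x| ≤ |f 0| + K * |x| := by
  have h := hf.dist_le_mul x 0
  rw [Real.dist_eq, Real.dist_eq, sub_zero] at h
  have := abs_sub_abs_le_abs_sub (f x) (f 0)
  linarith

theorem LipschitzWith.tendsto_gaussianPDFReal_mul {K : NNReal} {f : ℝ → ℝ}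
    (hf : LipschitzWith K f) :
    Tendsto (fun x => gaussianPDFReal 0 1 x * f x) (cocompact ℝ) (nhds 0) := by
  have h0 := tendsto_rpow_abs_mul_exp_neg_mul_sq_cocompact (a := 1 / 2) (by norm_num) 0
  have h1 := tendsto_rpow_abs_mul_exp_neg_mul_sq_cocompact (a := 1 / 2) (by norm_num) 1
  have h := ((h0.const_mul |f 0|).add (h1.const_mul (K : ℝ))).const_mul
    (√(2 * π * ((1 : NNReal) : ℝ)))⁻¹
  simp only [mul_zero, add_zero] at h
  refine squeeze_zero_norm (fun x => ?_) h
  rw [norm_mul, Real.norm_eq_abs, Real.norm_eq_abs, abs_of_nonneg (gaussianPDFReal_nonneg _ _ _)]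
  refine (mul_le_mul_of_nonneg_left (hf.abs_le_add x) (gaussianPDFReal_nonneg _ _ _)).trans
    (le_of_eq ?_)
  rw [gaussianPDFReal_def]
  have e : -(x - 0) ^ 2 / (2 * ((1 : NNReal) : ℝ)) = -(1 / 2) * x ^ 2 := by
    simp; ring
  simp only [e, Real.rpow_zero, Real.rpow_one]
  ring

theorem memLp_id_stdGaussian : MemLp (fun z : ℝ => z) 2 stdGaussian :=
  memLp_id_gaussianReal' 2 (by simp)

theorem LipschitzWith.memLp_stdGaussian {K : NNReal} {f : ℝ → ℝ} (hf : LipschitzWith K f) :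
    MemLp f 2 stdGaussian := by
  refine ((memLp_const |f 0|).add (memLp_id_stdGaussian.norm.const_mul (K : ℝ))).mono
    hf.continuous.aestronglyMeasurable (ae_of_all _ fun x => ?_)
  rw [Real.norm_eq_abs]
  exact (hf.abs_le_add x).trans (le_abs_self _)

/-- Stein's identity for a Lipschitz function which is differentiable off a countable set. -/
theorem integral_id_mul_stdGaussian {K : NNReal} {f f' : ℝ → ℝ} {s : Set ℝ} (hs : s.Countable)
    (hf : LipschitzWith K f) (hf' : ∀ x ∉ s, HasDerivAt f (f' x) x)
    (hintd : Integrable f' stdGaussian) :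
    ∫ z, z * f z ∂stdGaussian = ∫ z, f' z ∂stdGaussian := by
  have hint2 : Integrable (fun z => z * f z) stdGaussian :=
    memLp_id_stdGaussian.integrable_mul hf.memLp_stdGaussian
  have i1 := (integrable_stdGaussian_iff _).1 hintd
  have i2 := (integrable_stdGaussian_iff _).1 hint2
  rw [← sub_eq_zero, ← integral_sub hint2 hintd, stdGaussian_integral_eq]
  set g : ℝ → ℝ := fun z => gaussianPDFReal 0 1 z * (z * f z - f' z) with hg
  have ig : Integrable g := by
    refine (i2.sub i1).congr (ae_of_all _ fun z => ?_)
    simp only [hg, Pi.sub_apply]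
    ring
  have hlim := intervalIntegral_tendsto_integral ig tendsto_neg_atTop_atBot tendsto_id
  have hft : ∀ R : ℝ, ∫ x in (-R)..R, g x
      = -(gaussianPDFReal 0 1 R * f R) - -(gaussianPDFReal 0 1 (-R) * f (-R)) := by
    intro R
    refine integral_eq_of_hasDerivAt_off_countable (fun x => -(gaussianPDFReal 0 1 x * f x)) g hs
      ?_ ?_ ig.intervalIntegrable
    · have : Continuous (gaussianPDFReal 0 1) := continuous_iff_continuousAt.2
        fun x => (hasDerivAt_gaussianPDFReal_std x).continuousAt
      exact (this.mul hf.continuous).neg.continuousOn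
    · intro x hx
      have := ((hasDerivAt_gaussianPDFReal_std x).mul (hf' x hx.2)).neg
      refine this.congr_deriv ?_
      simp only [hg]
      ring
  have hlim2 : Tendsto (fun R : ℝ => ∫ x in (-R)..R, g x) atTop (nhds 0) := by
    simp only [hft]
    have ht := hf.tendsto_gaussianPDFReal_mul
    have b := (ht.mono_left (atBot_le_cocompact (α := ℝ))).comp tendsto_neg_atTop_atBot
    simpa using (ht.mono_left (atTop_le_cocompact (α := ℝ))).neg.sub b.neg
  exact tendsto_nhds_unique hlim hlim2

/-- The estimation error of the proximal operator at `(b, z)`, at noise level `τ` and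
threshold `θ`. -/
def resid (η : ℝ → ℝ → ℝ) (τ θ : ℝ) (p : ℝ × ℝ) : ℝ := η (p.1 + τ * p.2) θ - p.1

/-- The mean square error. -/
def errSq (η : ℝ → ℝ → ℝ) (μB : Measure ℝ) (τ θ : ℝ) : ℝ :=
  ∫ p, resid η τ θ p ^ 2 ∂(μB.prod _root_.stdGaussian)

/-- The correlation between the Gaussian noise and the error. -/
def errCorr (η : ℝ → ℝ → ℝ) (μB : Measure ℝ) (τ θ : ℝ) : ℝ :=
  ∫ p, p.2 * resid η τ θ p ∂(μB.prod _root_.stdGaussian)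

theorem memLp_fst_prod_stdGaussian {μB : Measure ℝ} [IsProbabilityMeasure μB]
    (hB : Integrable (fun b => b ^ 2) μB) :
    MemLp (fun p : ℝ × ℝ => p.1) 2 (μB.prod _root_.stdGaussian) :=
  ((memLp_two_iff_integrable_sq (f := fun b : ℝ => b)
    measurable_id.aestronglyMeasurable).2 hB).comp_fst _

theorem memLp_snd_prod_stdGaussian {μB : Measure ℝ} [IsProbabilityMeasure μB] :
    MemLp (fun p : ℝ × ℝ => p.2) 2 (μB.prod _root_.stdGaussian) :=
  memLp_id_stdGaussian.comp_snd _

theorem integral_fst_mul_snd_prod_stdGaussian {μB : Measure ℝ} [IsProbabilityMeasure μB] :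
    ∫ p : ℝ × ℝ, p.1 * p.2 ∂(μB.prod _root_.stdGaussian) = 0 := by
  rw [integral_prod_mul (fun b : ℝ => b) (fun z : ℝ => z)]
  have : ∫ z, z ∂_root_.stdGaussian = 0 := integral_id_gaussianReal
  rw [this, mul_zero]

theorem abs_resid_le {q : ℝ} {η : ℝ → ℝ → ℝ} (hq : 1 ≤ q)
    (hη : ∀ u χ, 0 ≤ χ → IsProx q χ u (η u χ)) {τ θ : ℝ} (hθ : 0 ≤ θ) (p : ℝ × ℝ) :
    |resid η τ θ p| ≤ 2 * |p.1| + |τ| * |p.2| := by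
  have h1 := (hη (p.1 + τ * p.2) θ hθ).abs_le hq hθ
  have h2 := abs_add_le p.1 (τ * p.2)
  have h3 := abs_sub (η (p.1 + τ * p.2) θ) p.1
  rw [abs_mul] at h2
  rw [resid]
  linarith

theorem continuous_resid {q : ℝ} {η : ℝ → ℝ → ℝ} (hq : 1 ≤ q)
    (hη : ∀ u χ, 0 ≤ χ → IsProx q χ u (η u χ)) {τ θ : ℝ} (hθ : 0 < θ) :
    Continuous (resid η τ θ) := by
  have := (IsProx.lipschitzWith hq hθ (fun u => hη u θ hθ.le)).continuous
  unfold resid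
  fun_prop

theorem memLp_envelope {μB : Measure ℝ} [IsProbabilityMeasure μB]
    (hB : Integrable (fun b => b ^ 2) μB) (a c : ℝ) :
    MemLp (fun p : ℝ × ℝ => a * |p.1| + c * |p.2|) 2 (μB.prod _root_.stdGaussian) :=
  ((memLp_fst_prod_stdGaussian hB).abs.const_mul a).add
    (memLp_snd_prod_stdGaussian.abs.const_mul c)

theorem memLp_resid {q : ℝ} {η : ℝ → ℝ → ℝ} (hq : 1 ≤ q)
    (hη : ∀ u χ, 0 ≤ χ → IsProx q χ u (η u χ)) {μB : Measure ℝ} [IsProbabilityMeasure μB]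
    (hB : Integrable (fun b => b ^ 2) μB) {τ θ : ℝ} (hθ : 0 < θ) :
    MemLp (resid η τ θ) 2 (μB.prod _root_.stdGaussian) := by
  refine (memLp_envelope hB 2 |τ|).mono (continuous_resid hq hη hθ).aestronglyMeasurable
    (ae_of_all _ fun p => ?_)
  exact (abs_resid_le hq hη hθ.le p).trans (le_abs_self _)

theorem continuousAt_resid {q : ℝ} {η : ℝ → ℝ → ℝ} (hq : 1 ≤ q)
    (hη : ∀ u χ, 0 ≤ χ → IsProx q χ u (η u χ)) {τ θ : ℝ} (hθ : 0 < θ) (p : ℝ × ℝ) :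
    ContinuousAt (fun x : ℝ × ℝ => resid η x.1 x.2 p) (τ, θ) := by
  have h := IsProx.continuousAt hq hη (u := p.1 + τ * p.2) hθ
  have h2 : ContinuousAt (fun x : ℝ × ℝ => (p.1 + x.1 * p.2, x.2)) (τ, θ) := by fun_prop
  exact (ContinuousAt.comp (f := fun x : ℝ × ℝ => (p.1 + x.1 * p.2, x.2)) h h2).sub
    continuousAt_const

theorem eventually_abs_resid_le {q : ℝ} {η : ℝ → ℝ → ℝ} (hq : 1 ≤ q)
    (hη : ∀ u χ, 0 ≤ χ → IsProx q χ u (η u χ)) {τ θ : ℝ} (hθ : 0 < θ) :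
    ∀ᶠ x : ℝ × ℝ in nhds (τ, θ), 0 < x.2 ∧
      ∀ p, |resid η x.1 x.2 p| ≤ 2 * |p.1| + (|τ| + 1) * |p.2| := by
  have h1 : ∀ᶠ x : ℝ × ℝ in nhds (τ, θ), 0 < x.2 :=
    (continuous_snd.tendsto (τ, θ)).eventually (lt_mem_nhds hθ)
  have h2 : ∀ᶠ x : ℝ × ℝ in nhds (τ, θ), |x.1| < |τ| + 1 :=
    (continuous_fst.abs.tendsto (τ, θ)).eventually (gt_mem_nhds (lt_add_one |τ|))
  filter_upwards [h1, h2] with x hx1 hx2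
  refine ⟨hx1, fun p => (abs_resid_le hq hη hx1.le p).trans ?_⟩
  gcongr

theorem continuousAt_errSq {q : ℝ} {η : ℝ → ℝ → ℝ} (hq : 1 ≤ q)
    (hη : ∀ u χ, 0 ≤ χ → IsProx q χ u (η u χ)) {μB : Measure ℝ} [IsProbabilityMeasure μB]
    (hB : Integrable (fun b => b ^ 2) μB) {τ θ : ℝ} (hθ : 0 < θ) :
    ContinuousAt (fun x : ℝ × ℝ => errSq η μB x.1 x.2) (τ, θ) := by
  unfold errSq
  refine continuousAt_of_dominated (bound := fun p => (2 * |p.1| + (|τ| + 1) * |p.2|) ^ 2)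
    ?_ ?_ (memLp_envelope hB 2 (|τ| + 1)).integrable_sq
    (ae_of_all _ fun p => (continuousAt_resid hq hη hθ p).pow 2)
  · filter_upwards [eventually_abs_resid_le hq hη hθ] with x hx
    exact ((continuous_resid hq hη hx.1).pow 2).aestronglyMeasurable
  · filter_upwards [eventually_abs_resid_le hq hη hθ] with x hx
    refine ae_of_all _ fun p => ?_
    rw [Real.norm_eq_abs, abs_pow]
    exact pow_le_pow_left₀ (abs_nonneg _) (hx.2 p) 2

theorem continuousAt_errCorr {q : ℝ} {η : ℝ → ℝ → ℝ} (hq : 1 ≤ q)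
    (hη : ∀ u χ, 0 ≤ χ → IsProx q χ u (η u χ)) {μB : Measure ℝ} [IsProbabilityMeasure μB]
    (hB : Integrable (fun b => b ^ 2) μB) {τ θ : ℝ} (hθ : 0 < θ) :
    ContinuousAt (fun x : ℝ × ℝ => errCorr η μB x.1 x.2) (τ, θ) := by
  unfold errCorr
  refine continuousAt_of_dominated
    (bound := fun p => |p.2| * (2 * |p.1| + (|τ| + 1) * |p.2|)) ?_ ?_
    (memLp_snd_prod_stdGaussian.abs.integrable_mul (memLp_envelope hB 2 (|τ| + 1)))
    (ae_of_all _ fun p => continuousAt_const.mul (continuousAt_resid hq hη hθ p))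
  · filter_upwards [eventually_abs_resid_le hq hη hθ] with x hx
    exact (continuous_snd.mul (continuous_resid hq hη hx.1)).aestronglyMeasurable
  · filter_upwards [eventually_abs_resid_le hq hη hθ] with x hx
    refine ae_of_all _ fun p => ?_
    rw [Real.norm_eq_abs, abs_mul]
    exact mul_le_mul_of_nonneg_left (hx.2 p) (abs_nonneg _)

theorem integrable_snd_mul_resid {q : ℝ} {η : ℝ → ℝ → ℝ} (hq : 1 ≤ q)
    (hη : ∀ u χ, 0 ≤ χ → IsProx q χ u (η u χ)) {μB : Measure ℝ} [IsProbabilityMeasure μB]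
    (hB : Integrable (fun b => b ^ 2) μB) {τ θ : ℝ} (hθ : 0 < θ) :
    Integrable (fun p : ℝ × ℝ => p.2 * resid η τ θ p) (μB.prod _root_.stdGaussian) :=
  memLp_snd_prod_stdGaussian.integrable_mul (memLp_resid hq hη hB hθ)

theorem integral_integral_sq_eq_errSq {q : ℝ} {η : ℝ → ℝ → ℝ} (hq : 1 ≤ q)
    (hη : ∀ u χ, 0 ≤ χ → IsProx q χ u (η u χ)) {μB : Measure ℝ} [IsProbabilityMeasure μB]
    (hB : Integrable (fun b => b ^ 2) μB) {τ θ : ℝ} (hθ : 0 < θ) :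
    ∫ b, (∫ z, (η (b + τ * z) θ - b) ^ 2 ∂_root_.stdGaussian) ∂μB = errSq η μB τ θ :=
  (integral_prod _ (memLp_resid hq hη hB hθ).integrable_sq).symm

/-- The derivative of a proximal operator, with the soft-thresholding convention at `q = 1`:
off a countable set it is a genuine derivative. -/
theorem exists_countable_hasDerivAt {q : ℝ} {η η' : ℝ → ℝ → ℝ} (hq : 1 ≤ q)
    (hη : ∀ u χ, 0 ≤ χ → IsProx q χ u (η u χ))
    (hη'1 : q = 1 → ∀ u χ, 0 ≤ χ → η' u χ = if χ < |u| then 1 else 0)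
    (hη'q : 1 < q → ∀ u χ, 0 < χ → HasDerivAt (fun v => η v χ) (η' u χ) u)
    {θ : ℝ} (hθ : 0 < θ) :
    ∃ s : Set ℝ, s.Countable ∧ ∀ u ∉ s, HasDerivAt (fun v => η v θ) (η' u θ) u := by
  rcases hq.eq_or_lt with rfl | hlt
  · refine ⟨{θ, -θ}, (Set.toFinite _).countable, fun u hu => ?_⟩
    rw [hη'1 rfl u θ hθ.le]
    refine IsProx.hasDerivAt_soft hθ (fun v => hη v θ hθ.le) fun h => hu ?_
    rcases eq_or_eq_neg_of_abs_eq h with h | h <;> simp [h]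
  · exact ⟨∅, Set.countable_empty, fun u _ => hη'q hlt u θ hθ⟩

theorem measurable_and_abs_le_proxDeriv {q : ℝ} {η η' : ℝ → ℝ → ℝ} (hq : 1 ≤ q)
    (hη : ∀ u χ, 0 ≤ χ → IsProx q χ u (η u χ))
    (hη'1 : q = 1 → ∀ u χ, 0 ≤ χ → η' u χ = if χ < |u| then 1 else 0)
    (hη'q : 1 < q → ∀ u χ, 0 < χ → HasDerivAt (fun v => η v χ) (η' u χ) u)
    {θ : ℝ} (hθ : 0 < θ) :
    Measurable (fun u => η' u θ) ∧ ∀ u, |η' u θ| ≤ 1 := by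
  rcases hq.eq_or_lt with rfl | hlt
  · have e : (fun u => η' u θ) = fun u => if θ < |u| then (1 : ℝ) else 0 :=
      funext fun u => hη'1 rfl u θ hθ.le
    refine ⟨?_, fun u => ?_⟩
    · rw [e]
      exact Measurable.ite (measurableSet_lt measurable_const measurable_id.abs)
        measurable_const measurable_const
    · rw [hη'1 rfl u θ hθ.le]
      split_ifs <;> simp
  · have e : (fun u => η' u θ) = deriv (fun v => η v θ) :=
      funext fun u => (hη'q hlt u θ hθ).deriv.symm
    refine ⟨by rw [e]; exact measurable_deriv _, fun u => ?_⟩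
    have hL := IsProx.lipschitzWith hq hθ (fun u => hη u θ hθ.le)
    have := norm_deriv_le_of_lipschitz hL (x₀ := u)
    rw [(hη'q hlt u θ hθ).deriv] at this
    simpa using this

theorem mul_integral_integral_proxDeriv_eq_errCorr {q : ℝ} {η η' : ℝ → ℝ → ℝ} (hq : 1 ≤ q)
    (hη : ∀ u χ, 0 ≤ χ → IsProx q χ u (η u χ))
    (hη'1 : q = 1 → ∀ u χ, 0 ≤ χ → η' u χ = if χ < |u| then 1 else 0)
    (hη'q : 1 < q → ∀ u χ, 0 < χ → HasDerivAt (fun v => η v χ) (η' u χ) u)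
    {μB : Measure ℝ} [IsProbabilityMeasure μB]
    (hB : Integrable (fun b => b ^ 2) μB) {τ θ : ℝ} (hτ : 0 < τ) (hθ : 0 < θ) :
    τ * ∫ b, (∫ z, η' (b + τ * z) θ ∂_root_.stdGaussian) ∂μB = errCorr η μB τ θ := by
  have hL := IsProx.lipschitzWith hq hθ (fun u => hη u θ hθ.le)
  obtain ⟨hm, hb⟩ := measurable_and_abs_le_proxDeriv hq hη hη'1 hη'q hθ
  obtain ⟨s, hs, hd⟩ := exists_countable_hasDerivAt hq hη hη'1 hη'q hθ
  rw [errCorr, integral_prod _ (integrable_snd_mul_resid hq hη hB hθ),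
    ← integral_const_mul]
  refine integral_congr_ae (ae_of_all _ fun b => ?_)
  have haff : Measurable fun z : ℝ => b + τ * z := by fun_prop
  have hinj : Function.Injective fun z : ℝ => b + τ * z := fun x y h => by
    simpa [hτ.ne'] using h
  have hstein := integral_id_mul_stdGaussian (K := τ.toNNReal) (f := fun z => η (b + τ * z) θ - b)
    (f' := fun z => τ * η' (b + τ * z) θ) (s := (fun z : ℝ => b + τ * z) ⁻¹' s)
    (hs.preimage hinj) ?_ ?_ ?_
  · rw [integral_const_mul] at hstein
    exact hstein.symm
  · refine LipschitzWith.of_dist_le_mul fun x y => ?_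
    have := hL.dist_le_mul (b + τ * x) (b + τ * y)
    rw [Real.dist_eq, Real.dist_eq] at this ⊢
    have e : b + τ * x - (b + τ * y) = τ * (x - y) := by ring
    rw [e, abs_mul, abs_of_pos hτ] at this
    simpa [Real.coe_toNNReal τ hτ.le] using this
  · intro x hx
    have h1 : HasDerivAt (fun z : ℝ => b + τ * z) τ x := by
      simpa using ((hasDerivAt_id x).const_mul τ).const_add b
    have h2 := ((hd (b + τ * x) hx).comp x h1).sub_const b
    exact h2.congr_deriv (mul_comm _ _)
  · refine Integrable.const_mul ?_ τ
    refine Integrable.of_bound (hm.comp haff).aestronglyMeasurable 1 (ae_of_all _ fun z => ?_)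
    exact hb _

/-- Integrated monotonicity of the subgradients, with the cross term split by Young's
inequality. -/
theorem integrated_monotonicity {q : ℝ} {η : ℝ → ℝ → ℝ} (hq : 1 ≤ q)
    (hη : ∀ u χ, 0 ≤ χ → IsProx q χ u (η u χ)) {μB : Measure ℝ} [IsProbabilityMeasure μB]
    (hB : Integrable (fun b => b ^ 2) μB) {τ₁ τ₂ θ₁ θ₂ lam r : ℝ} (hlam : 0 < lam)
    (hθ₁ : 0 < θ₁) (hθ₂ : 0 < θ₂) (hr : 0 < r) :
    0 ≤ (lam / θ₁ * τ₁ - lam / θ₂ * τ₂) * (errCorr η μB τ₁ θ₁ - errCorr η μB τ₂ θ₂)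
      + ((lam / θ₁ + lam / θ₂) * r / 2 - lam / θ₁) * errSq η μB τ₁ θ₁
      + ((lam / θ₁ + lam / θ₂) * r⁻¹ / 2 - lam / θ₂) * errSq η μB τ₂ θ₂ := by
  have m₁ := memLp_resid (τ := τ₁) hq hη hB hθ₁
  have m₂ := memLp_resid (τ := τ₂) hq hη hB hθ₂
  have s₁ := m₁.integrable_sq
  have s₂ := m₂.integrable_sq
  have t₁ := integrable_snd_mul_resid (τ := τ₁) hq hη hB hθ₁
  have t₂ := integrable_snd_mul_resid (τ := τ₂) hq hη hB hθ₂
  set c₁ := lam / θ₁ with hc₁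
  set c₂ := lam / θ₂ with hc₂
  have hc₁0 : 0 < c₁ := by positivity
  have hc₂0 : 0 < c₂ := by positivity
  have key : 0 ≤ ∫ p : ℝ × ℝ, ((c₁ * τ₁ - c₂ * τ₂) * (p.2 * resid η τ₁ θ₁ p - p.2 * resid η τ₂ θ₂ p)
      + ((c₁ + c₂) * r / 2 - c₁) * resid η τ₁ θ₁ p ^ 2
      + ((c₁ + c₂) * r⁻¹ / 2 - c₂) * resid η τ₂ θ₂ p ^ 2) ∂(μB.prod _root_.stdGaussian) := by
    refine integral_nonneg fun p => ?_
    have hm := (hη (p.1 + τ₁ * p.2) θ₁ hθ₁.le).monotone_subgradient hq hθ₁ hθ₂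
      (hη (p.1 + τ₂ * p.2) θ₂ hθ₂.le)
    have e₁ : η (p.1 + τ₁ * p.2) θ₁ = p.1 + resid η τ₁ θ₁ p := by rw [resid]; ring
    have e₂ : η (p.1 + τ₂ * p.2) θ₂ = p.1 + resid η τ₂ θ₂ p := by rw [resid]; ring
    rw [e₁, e₂] at hm
    set w₁ := resid η τ₁ θ₁ p
    set w₂ := resid η τ₂ θ₂ p
    have hm2 : 0 ≤ (c₁ * (τ₁ * p.2 - w₁) - c₂ * (τ₂ * p.2 - w₂)) * (w₁ - w₂) := by
      have := mul_nonneg hlam.le hm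
      refine this.trans_eq ?_
      rw [hc₁, hc₂]
      ring
    have hy : 2 * (w₁ * w₂) ≤ r * w₁ ^ 2 + r⁻¹ * w₂ ^ 2 := by
      have h : 0 ≤ r⁻¹ * (r * w₁ - w₂) ^ 2 := by positivity
      have e : r⁻¹ * (r * w₁ - w₂) ^ 2 = r * w₁ ^ 2 + r⁻¹ * w₂ ^ 2 - 2 * (w₁ * w₂) := by
        field_simp
        ring
      linarith
    have hy2 := mul_le_mul_of_nonneg_left hy (add_pos hc₁0 hc₂0).le
    simp only [Pi.zero_apply]
    linarith
  have i₁ : Integrable (fun p : ℝ × ℝ => (c₁ * τ₁ - c₂ * τ₂) *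
      (p.2 * resid η τ₁ θ₁ p - p.2 * resid η τ₂ θ₂ p)) (μB.prod _root_.stdGaussian) :=
    (t₁.sub t₂).const_mul _
  have i₂ : Integrable (fun p : ℝ × ℝ => (c₁ * τ₁ - c₂ * τ₂) *
      (p.2 * resid η τ₁ θ₁ p - p.2 * resid η τ₂ θ₂ p)
      + ((c₁ + c₂) * r / 2 - c₁) * resid η τ₁ θ₁ p ^ 2) (μB.prod _root_.stdGaussian) :=
    i₁.add (s₁.const_mul _)
  rw [integral_add i₂ (s₂.const_mul _), integral_add i₁ (s₁.const_mul _), integral_const_mul,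
    integral_const_mul, integral_const_mul, integral_sub t₁ t₂] at key
  exact key

/-- The reduced fixed-point system has at most one solution. -/
theorem fixedPoint_unique {q : ℝ} {η : ℝ → ℝ → ℝ} (hq : 1 ≤ q)
    (hη : ∀ u χ, 0 ≤ χ → IsProx q χ u (η u χ)) {μB : Measure ℝ} [IsProbabilityMeasure μB]
    (hB : Integrable (fun b => b ^ 2) μB) {lam δ σ τ₁ τ₂ θ₁ θ₂ : ℝ} (hlam : 0 < lam)
    (hδ : 0 < δ) (hσ : 0 < σ) (hτ₁ : 0 < τ₁) (hτ₂ : 0 < τ₂) (hθ₁ : 0 < θ₁) (hθ₂ : 0 < θ₂)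
    (hS₁ : errSq η μB τ₁ θ₁ = δ * (τ₁ ^ 2 - σ ^ 2))
    (hS₂ : errSq η μB τ₂ θ₂ = δ * (τ₂ ^ 2 - σ ^ 2))
    (hT₁ : errCorr η μB τ₁ θ₁ = δ * (τ₁ - lam / θ₁ * τ₁))
    (hT₂ : errCorr η μB τ₂ θ₂ = δ * (τ₂ - lam / θ₂ * τ₂)) : τ₁ = τ₂ ∧ θ₁ = θ₂ := by
  have h := integrated_monotonicity (τ₁ := τ₁) (τ₂ := τ₂) (r := τ₂ / τ₁) hq hη hB hlam hθ₁ hθ₂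
    (by positivity)
  rw [hS₁, hS₂, hT₁, hT₂] at h
  have hc₁0 : 0 < lam / θ₁ := by positivity
  have hc₂0 : 0 < lam / θ₂ := by positivity
  have hinj : lam / θ₁ = lam / θ₂ → θ₁ = θ₂ := fun h => by
    rw [div_eq_div_iff hθ₁.ne' hθ₂.ne'] at h
    exact (mul_left_cancel₀ hlam.ne' h).symm
  set c₁ := lam / θ₁
  set c₂ := lam / θ₂
  have e : (c₁ * τ₁ - c₂ * τ₂) * (δ * (τ₁ - c₁ * τ₁) - δ * (τ₂ - c₂ * τ₂))
      + ((c₁ + c₂) * (τ₂ / τ₁) / 2 - c₁) * (δ * (τ₁ ^ 2 - σ ^ 2))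
      + ((c₁ + c₂) * (τ₂ / τ₁)⁻¹ / 2 - c₂) * (δ * (τ₂ ^ 2 - σ ^ 2))
      = -δ * ((c₁ * τ₁ - c₂ * τ₂) ^ 2
        + σ ^ 2 * (c₁ + c₂) / (2 * (τ₁ * τ₂)) * (τ₁ - τ₂) ^ 2) := by
    field_simp
    ring
  rw [e] at h
  have hk : 0 < σ ^ 2 * (c₁ + c₂) / (2 * (τ₁ * τ₂)) := by positivity
  set k := σ ^ 2 * (c₁ + c₂) / (2 * (τ₁ * τ₂))
  have hsum : (c₁ * τ₁ - c₂ * τ₂) ^ 2 + k * (τ₁ - τ₂) ^ 2 ≤ 0 := by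
    by_contra! hcon
    have := mul_pos hδ hcon
    linarith
  have hk2 : 0 ≤ k * (τ₁ - τ₂) ^ 2 := by positivity
  have hτ : τ₁ = τ₂ := by
    have h0 : k * (τ₁ - τ₂) ^ 2 = 0 := le_antisymm (by nlinarith [sq_nonneg (c₁ * τ₁ - c₂ * τ₂)]) hk2
    have := (mul_eq_zero.1 h0).resolve_left hk.ne'
    exact sub_eq_zero.1 (pow_eq_zero_iff two_ne_zero |>.1 this)
  have hβ : c₁ * τ₁ = c₂ * τ₂ := by
    have h0 : (c₁ * τ₁ - c₂ * τ₂) ^ 2 = 0 := le_antisymm (by linarith) (sq_nonneg _)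
    exact sub_eq_zero.1 (pow_eq_zero_iff two_ne_zero |>.1 h0)
  refine ⟨hτ, hinj ?_⟩
  rw [hτ] at hβ
  exact mul_right_cancel₀ hτ₂.ne' hβ

/-- An implicit function theorem for functions that are strictly decreasing in one variable. -/
theorem exists_continuousAt_implicit {f : ℝ → ℝ → ℝ}
    (hc : ∀ τ > 0, ∀ θ > 0, ContinuousAt (fun x : ℝ × ℝ => f x.1 x.2) (τ, θ))
    (hanti : ∀ τ > 0, StrictAntiOn (f τ) (Ioi 0))
    (hpos : ∀ τ > 0, ∃ θ > 0, 0 < f τ θ) (hneg : ∀ τ > 0, ∃ θ > 0, f τ θ < 0) :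
    ∃ g : ℝ → ℝ, ∀ τ > 0, 0 < g τ ∧ f τ (g τ) = 0 ∧ ContinuousAt g τ := by
  have hex : ∀ τ : ℝ, ∃ θ : ℝ, 0 < τ → 0 < θ ∧ f τ θ = 0 := by
    intro τ
    by_cases hτ : 0 < τ
    · obtain ⟨a, ha, hfa⟩ := hpos τ hτ
      obtain ⟨b, hb, hfb⟩ := hneg τ hτ
      have hcont : ContinuousOn (f τ) (Ioi 0) := fun θ hθ =>
        (ContinuousAt.comp (f := fun t : ℝ => (τ, t)) (hc τ hτ θ hθ)
          (by fun_prop)).continuousWithinAt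
      obtain ⟨θ, hθ, h0⟩ := isPreconnected_Ioi.intermediate_value hb ha hcont
        ⟨hfb.le, hfa.le⟩
      exact ⟨θ, fun _ => ⟨hθ, h0⟩⟩
    · exact ⟨0, fun h => absurd h hτ⟩
  choose g hg using hex
  refine ⟨g, fun τ hτ => ⟨(hg τ hτ).1, (hg τ hτ).2, ?_⟩⟩
  obtain ⟨hgpos, hg0⟩ := hg τ hτ
  have hsec : ∀ θ > 0, ContinuousAt (fun t => f t θ) τ := fun θ hθ =>
    ContinuousAt.comp (f := fun t : ℝ => (t, θ)) (hc τ hτ θ hθ) (by fun_prop)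
  refine tendsto_order.2 ⟨fun a ha => ?_, fun b hb => ?_⟩
  · set a' := max a (g τ / 2) with ha'
    have ha'pos : 0 < a' := lt_max_of_lt_right (by linarith)
    have ha'lt : a' < g τ := max_lt ha (by linarith)
    have hfa : 0 < f τ a' := by
      rw [← hg0]; exact hanti τ hτ ha'pos hgpos ha'lt
    filter_upwards [(hsec a' ha'pos).eventually (lt_mem_nhds hfa), lt_mem_nhds hτ] with t ht htpos
    refine lt_of_le_of_lt (le_max_left a (g τ / 2)) ?_
    rw [← (hanti t htpos).lt_iff_gt (hg t htpos).1 ha'pos, (hg t htpos).2]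
    exact ht
  · have hbpos : 0 < b := hgpos.trans hb
    have hfb : f τ b < 0 := by
      rw [← hg0]; exact hanti τ hτ hgpos hbpos hb
    filter_upwards [(hsec b hbpos).eventually (gt_mem_nhds hfb), lt_mem_nhds hτ] with t ht htpos
    rw [← (hanti t htpos).lt_iff_gt hbpos (hg t htpos).1, (hg t htpos).2]
    exact ht

/-- The derivative, in the dual variable `β = λτ/θ`, of the scalar min-max objective
associated with the fixed-point system. -/
def dualGap (η : ℝ → ℝ → ℝ) (μB : Measure ℝ) (lam δ σ τ θ : ℝ) : ℝ :=
  lam * τ / θ - (σ ^ 2 / τ + τ) / 2 - (errSq η μB τ θ / (2 * τ) - errCorr η μB τ θ) / δ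

theorem continuousAt_dualGap {q : ℝ} {η : ℝ → ℝ → ℝ} (hq : 1 ≤ q)
    (hη : ∀ u χ, 0 ≤ χ → IsProx q χ u (η u χ)) {μB : Measure ℝ} [IsProbabilityMeasure μB]
    (hB : Integrable (fun b => b ^ 2) μB) {lam δ σ τ θ : ℝ} (hτ : 0 < τ) (hθ : 0 < θ) :
    ContinuousAt (fun x : ℝ × ℝ => dualGap η μB lam δ σ x.1 x.2) (τ, θ) := by
  have hS := continuousAt_errSq (τ := τ) hq hη hB hθ
  have hT := continuousAt_errCorr (τ := τ) hq hη hB hθ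
  have h1 : ContinuousAt (fun x : ℝ × ℝ => x.1) (τ, θ) := continuousAt_fst
  have h2 : ContinuousAt (fun x : ℝ × ℝ => x.2) (τ, θ) := continuousAt_snd
  unfold dualGap
  exact ((((h1.const_mul lam).div h2 hθ.ne').sub
    (((continuousAt_const.div h1 hτ.ne').add h1).div_const 2)).sub
    (((hS.div (h1.const_mul 2) (by simpa using hτ.ne')).sub hT).div_const δ))

theorem strictAntiOn_dualGap {q : ℝ} {η : ℝ → ℝ → ℝ} (hq : 1 ≤ q)
    (hη : ∀ u χ, 0 ≤ χ → IsProx q χ u (η u χ)) {μB : Measure ℝ} [IsProbabilityMeasure μB]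
    (hB : Integrable (fun b => b ^ 2) μB) {lam δ σ τ : ℝ} (hlam : 0 < lam) (hδ : 0 < δ)
    (hτ : 0 < τ) : StrictAntiOn (dualGap η μB lam δ σ τ) (Ioi 0) := by
  intro θ₁ hθ₁ θ₂ hθ₂ hlt
  rw [Set.mem_Ioi] at hθ₁ hθ₂
  have hk : errSq η μB τ θ₁ / (2 * τ) - errCorr η μB τ θ₁
      ≤ errSq η μB τ θ₂ / (2 * τ) - errCorr η μB τ θ₂ := by
    have s₁ := (memLp_resid (τ := τ) hq hη hB hθ₁).integrable_sq
    have s₂ := (memLp_resid (τ := τ) hq hη hB hθ₂).integrable_sq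
    have t₁ := integrable_snd_mul_resid (τ := τ) hq hη hB hθ₁
    have t₂ := integrable_snd_mul_resid (τ := τ) hq hη hB hθ₂
    rw [errSq, errSq, errCorr, errCorr, ← integral_div, ← integral_div,
      ← integral_sub (s₁.div_const _) t₁, ← integral_sub (s₂.div_const _) t₂]
    refine integral_mono ((s₁.div_const _).sub t₁) ((s₂.div_const _).sub t₂) fun p => ?_
    have p₁ := hη (p.1 + τ * p.2) θ₁ hθ₁.le (η (p.1 + τ * p.2) θ₂)
    have p₂ := hη (p.1 + τ * p.2) θ₂ hθ₂.le (η (p.1 + τ * p.2) θ₁)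
    have e₁ : η (p.1 + τ * p.2) θ₁ = p.1 + resid η τ θ₁ p := by rw [resid]; ring
    have e₂ : η (p.1 + τ * p.2) θ₂ = p.1 + resid η τ θ₂ p := by rw [resid]; ring
    simp only [e₁, e₂] at p₁ p₂
    generalize |p.1 + resid η τ θ₁ p| ^ q = A₁ at *
    generalize |p.1 + resid η τ θ₂ p| ^ q = A₂ at *
    set w₁ := resid η τ θ₁ p
    set w₂ := resid η τ θ₂ p
    have h : (θ₂ - θ₁) * ((τ * p.2 - w₁) ^ 2 / 2 - (τ * p.2 - w₂) ^ 2 / 2) ≤ 0 := by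
      have := add_le_add (mul_le_mul_of_nonneg_left p₁ hθ₂.le)
        (mul_le_mul_of_nonneg_left p₂ hθ₁.le)
      linarith
    have h' : (τ * p.2 - w₁) ^ 2 / 2 - (τ * p.2 - w₂) ^ 2 / 2 ≤ 0 := by
      by_contra! hcon
      have := mul_pos (sub_pos.2 hlt) hcon
      linarith
    have e : w₁ ^ 2 / (2 * τ) - p.2 * w₁ - (w₂ ^ 2 / (2 * τ) - p.2 * w₂)
        = ((τ * p.2 - w₁) ^ 2 / 2 - (τ * p.2 - w₂) ^ 2 / 2) / τ := by
      field_simp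
      ring
    exact sub_nonpos.1 (e.trans_le (div_nonpos_of_nonpos_of_nonneg h' hτ.le))
  have h1 : lam * τ / θ₂ < lam * τ / θ₁ := div_lt_div_of_pos_left (by positivity) hθ₁ hlt
  have h2 := div_le_div_of_nonneg_right hk hδ.le
  unfold dualGap
  linarith

theorem errSq_nonneg (η : ℝ → ℝ → ℝ) (μB : Measure ℝ) (τ θ : ℝ) : 0 ≤ errSq η μB τ θ :=
  integral_nonneg fun _ => sq_nonneg _

theorem exists_dualGap_pos {q : ℝ} {η : ℝ → ℝ → ℝ} (hq : 1 ≤ q)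
    (hη : ∀ u χ, 0 ≤ χ → IsProx q χ u (η u χ)) {μB : Measure ℝ} [IsProbabilityMeasure μB]
    (hB : Integrable (fun b => b ^ 2) μB) {lam δ σ τ : ℝ} (hlam : 0 < lam) (hδ : 0 < δ)
    (hτ : 0 < τ) : ∃ θ > 0, 0 < dualGap η μB lam δ σ τ θ := by
  have hE := memLp_envelope hB 2 |τ|
  set A := ∫ p : ℝ × ℝ, (2 * |p.1| + |τ| * |p.2|) ^ 2 ∂(μB.prod _root_.stdGaussian)
  set C := ∫ p : ℝ × ℝ, |p.2| * (2 * |p.1| + |τ| * |p.2|) ∂(μB.prod _root_.stdGaussian)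
  have hA : ∀ θ > 0, errSq η μB τ θ ≤ A := fun θ hθ =>
    integral_mono (memLp_resid hq hη hB hθ).integrable_sq hE.integrable_sq fun p => by
      have := pow_le_pow_left₀ (abs_nonneg _) (abs_resid_le (τ := τ) hq hη hθ.le p) 2
      rwa [sq_abs] at this
  have hC : ∀ θ > 0, -errCorr η μB τ θ ≤ C := fun θ hθ => by
    rw [errCorr, ← integral_neg]
    refine integral_mono (integrable_snd_mul_resid hq hη hB hθ).neg
      (memLp_snd_prod_stdGaussian.abs.integrable_mul hE) fun p => ?_
    refine (neg_le_abs _).trans ?_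
    rw [abs_mul]
    exact mul_le_mul_of_nonneg_left (abs_resid_le (τ := τ) hq hη hθ.le p) (abs_nonneg _)
  set D := |(σ ^ 2 / τ + τ) / 2 + (A / (2 * τ) + C) / δ| + 1 with hD
  have hD0 : 0 < D := by positivity
  have hθ : 0 < lam * τ / (2 * D) := by positivity
  refine ⟨lam * τ / (2 * D), hθ, ?_⟩
  have e : lam * τ / (lam * τ / (2 * D)) = 2 * D := by field_simp
  have h1 : (errSq η μB τ (lam * τ / (2 * D)) / (2 * τ) - errCorr η μB τ (lam * τ / (2 * D))) / δ
      ≤ (A / (2 * τ) + C) / δ := by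
    have := hA _ hθ
    have := hC _ hθ
    have : errSq η μB τ (lam * τ / (2 * D)) / (2 * τ) ≤ A / (2 * τ) := by gcongr
    gcongr
    linarith
  have h2 := le_abs_self ((σ ^ 2 / τ + τ) / 2 + (A / (2 * τ) + C) / δ)
  rw [dualGap, e]
  linarith

/-- The proximal operator vanishes in the limit of a large threshold. -/
theorem IsProx.tendsto_zero {q : ℝ} {η : ℝ → ℝ → ℝ} (hq : 1 ≤ q)
    (hη : ∀ u χ, 0 ≤ χ → IsProx q χ u (η u χ)) (u : ℝ) :
    Tendsto (fun θ => η u θ) atTop (nhds 0) := by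
  have h0 : Tendsto (fun θ : ℝ => (u ^ 2 / θ) ^ (1 / q)) atTop (nhds 0) := by
    have h1 : Tendsto (fun θ : ℝ => u ^ 2 / θ) atTop (nhds 0) :=
      tendsto_const_nhds.div_atTop tendsto_id
    have h2 := h1.rpow_const (p := 1 / q) (Or.inr (by positivity))
    rwa [Real.zero_rpow (by positivity)] at h2
  refine squeeze_zero_norm' ?_ h0
  filter_upwards [eventually_gt_atTop 0] with θ hθ
  have h1 := (hη u θ hθ.le).mul_abs_rpow_le hq hθ.le
  have h2 : |η u θ| ^ q ≤ u ^ 2 / θ := by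
    rw [le_div_iff₀ hθ]
    nlinarith [sq_nonneg (u - η u θ), sq_nonneg u, sq_nonneg (η u θ)]
  have h3 := Real.rpow_le_rpow (by positivity) h2 (by positivity : 0 ≤ 1 / q)
  rwa [← Real.rpow_mul (abs_nonneg _), mul_one_div_cancel (by positivity), Real.rpow_one] at h3

theorem tendsto_errCorr_atTop {q : ℝ} {η : ℝ → ℝ → ℝ} (hq : 1 ≤ q)
    (hη : ∀ u χ, 0 ≤ χ → IsProx q χ u (η u χ)) {μB : Measure ℝ} [IsProbabilityMeasure μB]
    (hB : Integrable (fun b => b ^ 2) μB) (τ : ℝ) :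
    Tendsto (fun θ => errCorr η μB τ θ) atTop (nhds 0) := by
  have hlim : ∫ p : ℝ × ℝ, p.2 * (0 - p.1) ∂(μB.prod _root_.stdGaussian) = 0 := by
    rw [← neg_eq_zero, ← integral_neg]
    refine Eq.trans ?_ (integral_fst_mul_snd_prod_stdGaussian (μB := μB))
    refine integral_congr_ae (ae_of_all _ fun p => ?_)
    simp only
    ring
  rw [← hlim]
  unfold errCorr
  refine tendsto_integral_filter_of_dominated_convergence
    (fun p => |p.2| * (2 * |p.1| + |τ| * |p.2|)) ?_ ?_
    (memLp_snd_prod_stdGaussian.abs.integrable_mul (memLp_envelope hB 2 |τ|))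
    (ae_of_all _ fun p => ?_)
  · filter_upwards [eventually_gt_atTop 0] with θ hθ
    exact (integrable_snd_mul_resid hq hη hB hθ).aestronglyMeasurable
  · filter_upwards [eventually_gt_atTop 0] with θ hθ
    refine ae_of_all _ fun p => ?_
    rw [Real.norm_eq_abs, abs_mul]
    exact mul_le_mul_of_nonneg_left (abs_resid_le (τ := τ) hq hη hθ.le p) (abs_nonneg _)
  · exact ((IsProx.tendsto_zero hq hη _).sub_const _).const_mul _

theorem exists_dualGap_neg {q : ℝ} {η : ℝ → ℝ → ℝ} (hq : 1 ≤ q)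
    (hη : ∀ u χ, 0 ≤ χ → IsProx q χ u (η u χ)) {μB : Measure ℝ} [IsProbabilityMeasure μB]
    (hB : Integrable (fun b => b ^ 2) μB) {lam δ σ τ : ℝ} (hδ : 0 < δ) (hτ : 0 < τ) :
    ∃ θ > 0, dualGap η μB lam δ σ τ θ < 0 := by
  have h1 : Tendsto (fun θ : ℝ => lam * τ / θ + errCorr η μB τ θ / δ) atTop (nhds (0 + 0 / δ)) :=
    (tendsto_const_nhds.div_atTop tendsto_id).add
      ((tendsto_errCorr_atTop hq hη hB τ).div_const δ)
  rw [zero_div, add_zero] at h1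
  have h2 := h1.eventually (gt_mem_nhds (half_pos hτ))
  obtain ⟨θ, hθ, hθpos⟩ := (h2.and (eventually_gt_atTop 0)).exists
  refine ⟨θ, hθpos, ?_⟩
  have h3 : 0 ≤ errSq η μB τ θ / (2 * τ) / δ := by
    have := errSq_nonneg η μB τ θ
    positivity
  have h4 : 0 ≤ σ ^ 2 / τ := by positivity
  rw [dualGap, sub_div]
  linarith

/-- Tails of the second moment of a square-integrable function can be made arbitrarily small. -/
theorem exists_integral_sq_tail_le {α : Type*} [MeasurableSpace α] {μ : Measure α} {Y : α → ℝ}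
    (hY : MemLp Y 2 μ) (hm : Measurable Y) {ε : ℝ} (hε : 0 < ε) :
    ∃ M : ℝ, 0 ≤ M ∧ ∫ p, {p | M < Y p}.indicator (fun p => Y p ^ 2) p ∂μ ≤ ε := by
  have hlim : Tendsto (fun n : ℕ => ∫ p, {p | (n : ℝ) < Y p}.indicator (fun p => Y p ^ 2) p ∂μ)
      atTop (nhds (∫ _, (0 : ℝ) ∂μ)) := by
    refine tendsto_integral_of_dominated_convergence (fun p => Y p ^ 2) (fun n => ?_)
      hY.integrable_sq (fun n => ae_of_all _ fun p => ?_) (ae_of_all _ fun p => ?_)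
    · exact ((hm.pow_const 2).indicator (measurableSet_lt measurable_const hm)).aestronglyMeasurable
    · refine (norm_indicator_le_norm_self _ _).trans (le_of_eq ?_)
      rw [Real.norm_eq_abs, abs_of_nonneg (sq_nonneg _)]
    · refine tendsto_const_nhds.congr' ?_
      obtain ⟨N, hN⟩ := exists_nat_ge (Y p)
      filter_upwards [eventually_ge_atTop N] with n hn
      rw [Set.indicator_of_notMem]
      exact not_lt.2 (hN.trans (by exact_mod_cast hn))
  rw [integral_zero] at hlim
  obtain ⟨n, hn⟩ := (hlim.eventually (gt_mem_nhds hε)).exists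
  exact ⟨n, n.cast_nonneg, hn.le⟩

theorem le_one_add_rpow {x q : ℝ} (hx : 0 ≤ x) (hq : 1 ≤ q) : x ≤ 1 + x ^ q := by
  rcases le_total x 1 with h | h
  · have := Real.rpow_nonneg hx q
    linarith
  · have := Real.rpow_le_rpow_of_exponent_le h hq
    rw [Real.rpow_one] at this
    linarith

set_option maxHeartbeats 2000000 in
/-- A priori bound: at large noise levels, every solution of the dual equation satisfies
the primal inequality. -/
theorem exists_forall_errSq_le {q : ℝ} {η : ℝ → ℝ → ℝ} (hq : 1 ≤ q)
    (hη : ∀ u χ, 0 ≤ χ → IsProx q χ u (η u χ)) {μB : Measure ℝ} [IsProbabilityMeasure μB]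
    (hB : Integrable (fun b => b ^ 2) μB) {lam δ σ : ℝ} (hlam : 0 < lam) (hδ : 0 < δ)
    (hσ : 0 < σ) : ∃ τ₀ : ℝ, ∀ τ ≥ τ₀, 0 < τ → ∀ θ > 0, dualGap η μB lam δ σ τ θ = 0 →
      errSq η μB τ θ ≤ δ * (τ ^ 2 - σ ^ 2) := by
  have hYL := memLp_envelope hB 1 1
  simp only [one_mul] at hYL
  have hYm : Measurable fun p : ℝ × ℝ => |p.1| + |p.2| := by fun_prop
  set P := μB.prod _root_.stdGaussian with hP
  set K := ∫ p : ℝ × ℝ, (|p.1| + |p.2|) ^ 2 ∂P with hK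
  have hK0 : 0 ≤ K := integral_nonneg fun _ => sq_nonneg _
  obtain ⟨M, hM0, hM⟩ := exists_integral_sq_tail_le hYL hYm (show 0 < δ / 8 by positivity)
  set C₂ := σ ^ 2 + 2 * K / δ with hC₂
  have hC₂0 : 0 < C₂ := by positivity
  set C₃ := C₂ ^ 2 * δ / lam with hC₃
  set D := 2 * M * (1 + C₃) + 2 * K + δ * σ ^ 2 with hD
  have hD0 : 0 < D := by positivity
  refine ⟨1 + 4 / (3 * δ) * D, fun τ hτ₀ hτ θ hθ hgap => ?_⟩
  have hτ1 : 1 ≤ τ := by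
    have : 0 < 4 / (3 * δ) * D := by positivity
    linarith
  by_contra! hcon
  have hS := (memLp_resid (τ := τ) hq hη hB hθ).integrable_sq
  have hT := integrable_snd_mul_resid (τ := τ) hq hη hB hθ
  have hb := memLp_fst_prod_stdGaussian hB
  have hz := memLp_snd_prod_stdGaussian (μB := μB)
  have hbW : Integrable (fun p : ℝ × ℝ => p.1 * resid η τ θ p) P :=
    hb.integrable_mul (memLp_resid hq hη hB hθ)
  have hbz : Integrable (fun p : ℝ × ℝ => p.1 * p.2) P := hb.integrable_mul hz
  have hb2 : Integrable (fun p : ℝ × ℝ => p.1 ^ 2) P := hb.integrable_sq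
  set S := errSq η μB τ θ with hSdef
  set T := errCorr η μB τ θ with hTdef
  set E := ∫ p : ℝ × ℝ, p.1 * resid η τ θ p ∂P with hE
  -- the mean of the pairing between the subgradient and the proximal point
  have iJ : Integrable (fun p : ℝ × ℝ => τ * (p.2 * resid η τ θ p) + τ * (p.1 * p.2)
      - p.1 * resid η τ θ p - resid η τ θ p ^ 2) P :=
    (((hT.const_mul τ).add (hbz.const_mul τ)).sub hbW).sub hS
  set J := ∫ p : ℝ × ℝ, (τ * (p.2 * resid η τ θ p) + τ * (p.1 * p.2)
      - p.1 * resid η τ θ p - resid η τ θ p ^ 2) ∂P with hJ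
  have hJeq : J = τ * T - E - S := by
    have i1 : Integrable (fun p : ℝ × ℝ => τ * (p.2 * resid η τ θ p) + τ * (p.1 * p.2)) P :=
      (hT.const_mul τ).add (hbz.const_mul τ)
    have i2 : Integrable (fun p : ℝ × ℝ => τ * (p.2 * resid η τ θ p) + τ * (p.1 * p.2)
        - p.1 * resid η τ θ p) P := i1.sub hbW
    rw [hJ, integral_sub i2 hS, integral_sub i1 hbW,
      integral_add (hT.const_mul τ) (hbz.const_mul τ), integral_const_mul, integral_const_mul,
      integral_fst_mul_snd_prod_stdGaussian, hSdef, hTdef, errSq, errCorr]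
    ring
  have hpair : ∀ p : ℝ × ℝ, θ * |p.1 + resid η τ θ p| ^ q ≤ τ * (p.2 * resid η τ θ p)
      + τ * (p.1 * p.2) - p.1 * resid η τ θ p - resid η τ θ p ^ 2 := by
    intro p
    have h := (hη (p.1 + τ * p.2) θ hθ.le).mul_abs_rpow_le hq hθ.le
    have e : η (p.1 + τ * p.2) θ = p.1 + resid η τ θ p := by rw [resid]; ring
    rw [e] at h
    linarith
  have hJ0 : 0 ≤ J := integral_nonneg fun p => le_trans (by positivity) (hpair p)
  have hWY : ∀ p : ℝ × ℝ, |resid η τ θ p| ≤ 2 * τ * (|p.1| + |p.2|) := by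
    intro p
    refine (abs_resid_le hq hη hθ.le p).trans ?_
    rw [abs_of_pos hτ]
    nlinarith [abs_nonneg p.1, abs_nonneg p.2, mul_nonneg hτ.le (abs_nonneg p.2),
      mul_nonneg (sub_nonneg.2 hτ1) (abs_nonneg p.1)]
  have hE0 : -E ≤ 2 * τ * K := by
    rw [hE, hK, ← integral_neg, ← integral_const_mul]
    refine integral_mono hbW.neg (hYL.integrable_sq.const_mul _) fun p => ?_
    refine (neg_le_abs _).trans ?_
    rw [abs_mul]
    calc |p.1| * |resid η τ θ p| ≤ (|p.1| + |p.2|) * (2 * τ * (|p.1| + |p.2|)) :=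
          mul_le_mul (le_add_of_nonneg_right (abs_nonneg _)) (hWY p) (abs_nonneg _) (by positivity)
      _ = 2 * τ * (|p.1| + |p.2|) ^ 2 := by ring
  -- the dual equation bounds the pairing and forces a large threshold
  have hmain : lam * τ / θ + J / (τ * δ) ≤ C₂ := by
    have hTJ : T = (J + E + S) / τ := by
      field_simp
      linarith
    have hg : lam * τ / θ = (σ ^ 2 / τ + τ) / 2 + (S / (2 * τ) - T) / δ := by
      unfold dualGap at hgap
      linarith
    have e : lam * τ / θ + J / (τ * δ)
        = (σ ^ 2 / τ + τ) / 2 - S / (2 * (τ * δ)) + -E / (τ * δ) := by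
      rw [hg, hTJ]
      field_simp
      ring
    have h1 : -E / (τ * δ) ≤ 2 * K / δ := by
      rw [div_le_div_iff₀ (by positivity) hδ]
      nlinarith
    have h2 : (σ ^ 2 / τ + τ) / 2 - S / (2 * (τ * δ)) ≤ σ ^ 2 / τ := by
      have h3 : δ * (τ ^ 2 - σ ^ 2) / (2 * (τ * δ)) ≤ S / (2 * (τ * δ)) := by gcongr
      have h4 : δ * (τ ^ 2 - σ ^ 2) / (2 * (τ * δ)) = τ / 2 - σ ^ 2 / τ / 2 := by
        field_simp
      linarith
    have h5 : σ ^ 2 / τ ≤ σ ^ 2 := div_le_self (sq_nonneg _) hτ1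
    rw [e]
    linarith
  have hJτ : 0 ≤ J / (τ * δ) := by positivity
  have hθlarge : lam * τ ≤ C₂ * θ := by
    rw [← div_le_iff₀ hθ]
    linarith
  have hJle : J ≤ C₂ * (τ * δ) := by
    rw [← div_le_iff₀ (by positivity)]
    have : 0 ≤ lam * τ / θ := by positivity
    linarith
  have hJθ : J / θ ≤ C₃ := by
    rw [div_le_iff₀ hθ, hC₃, div_mul_eq_mul_div, le_div_iff₀ hlam]
    calc J * lam ≤ C₂ * (τ * δ) * lam := by gcongr
      _ = C₂ * δ * (lam * τ) := by ring
      _ ≤ C₂ * δ * (C₂ * θ) := by gcongr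
      _ = C₂ ^ 2 * δ * θ := by ring
  -- uniform integrability turns this into a bound on the mean square error
  have hind : Integrable (fun p : ℝ × ℝ => {p : ℝ × ℝ | M < |p.1| + |p.2|}.indicator
      (fun p => (|p.1| + |p.2|) ^ 2) p) P :=
    hYL.integrable_sq.indicator (measurableSet_lt measurable_const hYm)
  have hSle : S ≤ 2 * τ * M * (1 + J / θ) + 2 * τ ^ 2 * (δ / 8) + 2 * K := by
    have iR₁ : Integrable (fun p : ℝ × ℝ => 2 * τ * M * (1 + (τ * (p.2 * resid η τ θ p)
        + τ * (p.1 * p.2) - p.1 * resid η τ θ p - resid η τ θ p ^ 2) / θ)) P :=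
      ((integrable_const 1).add (iJ.div_const θ)).const_mul _
    have iR₂ : Integrable (fun p : ℝ × ℝ => 2 * τ * M * (1 + (τ * (p.2 * resid η τ θ p)
        + τ * (p.1 * p.2) - p.1 * resid η τ θ p - resid η τ θ p ^ 2) / θ)
        + 2 * τ ^ 2 * {p : ℝ × ℝ | M < |p.1| + |p.2|}.indicator
          (fun p => (|p.1| + |p.2|) ^ 2) p) P := iR₁.add (hind.const_mul _)
    have hle : S ≤ ∫ p : ℝ × ℝ, (2 * τ * M * (1 + (τ * (p.2 * resid η τ θ p)
        + τ * (p.1 * p.2) - p.1 * resid η τ θ p - resid η τ θ p ^ 2) / θ)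
        + 2 * τ ^ 2 * {p : ℝ × ℝ | M < |p.1| + |p.2|}.indicator
          (fun p => (|p.1| + |p.2|) ^ 2) p + 2 * (|p.1| + |p.2|) ^ 2) ∂P := by
      refine integral_mono hS (iR₂.add (hYL.integrable_sq.const_mul _)) fun p => ?_
      have hv := (hη (p.1 + τ * p.2) θ hθ.le).abs_le hq hθ.le
      have e : η (p.1 + τ * p.2) θ = p.1 + resid η τ θ p := by rw [resid]; ring
      rw [e] at hv
      have hu := abs_add_le p.1 (τ * p.2)
      rw [abs_mul, abs_of_pos hτ] at hu
      have hvY : |p.1 + resid η τ θ p| ≤ τ * (|p.1| + |p.2|) := by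
        nlinarith [mul_nonneg (sub_nonneg.2 hτ1) (abs_nonneg p.1)]
      have hone := le_one_add_rpow (abs_nonneg (p.1 + resid η τ θ p)) hq
      have hpq := hpair p
      rw [mul_comm, ← le_div_iff₀ hθ] at hpq
      have hfirst : |p.1 + resid η τ θ p| ≤ 1 + (τ * (p.2 * resid η τ θ p)
        + τ * (p.1 * p.2) - p.1 * resid η τ θ p - resid η τ θ p ^ 2) / θ := by linarith
      have hb1 : p.1 ^ 2 ≤ (|p.1| + |p.2|) ^ 2 := by
        rw [← sq_abs p.1]
        exact pow_le_pow_left₀ (abs_nonneg _) (le_add_of_nonneg_right (abs_nonneg _)) 2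
      have hsplit : resid η τ θ p ^ 2 ≤ 2 * |p.1 + resid η τ θ p| ^ 2 + 2 * p.1 ^ 2 := by
        rw [sq_abs]
        nlinarith [sq_nonneg (2 * p.1 + resid η τ θ p)]
      have hv2 : |p.1 + resid η τ θ p| ^ 2 ≤ τ * M * |p.1 + resid η τ θ p|
          + τ ^ 2 * {p : ℝ × ℝ | M < |p.1| + |p.2|}.indicator
            (fun p => (|p.1| + |p.2|) ^ 2) p := by
        have hv0 := abs_nonneg (p.1 + resid η τ θ p)
        by_cases hp : M < |p.1| + |p.2|
        · rw [Set.indicator_of_mem (show p ∈ {p : ℝ × ℝ | M < |p.1| + |p.2|} from hp), ← mul_pow]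
          have := pow_le_pow_left₀ hv0 hvY 2
          have : 0 ≤ τ * M * |p.1 + resid η τ θ p| := by positivity
          linarith
        · rw [Set.indicator_of_notMem (show p ∉ {p : ℝ × ℝ | M < |p.1| + |p.2|} from hp),
            mul_zero, add_zero, sq]
          refine mul_le_mul_of_nonneg_right (hvY.trans ?_) hv0
          exact mul_le_mul_of_nonneg_left (not_lt.1 hp) hτ.le
      have hfirst' := mul_le_mul_of_nonneg_left hfirst (show 0 ≤ τ * M by positivity)
      simp only
      linarith
    rw [integral_add iR₂ (hYL.integrable_sq.const_mul _), integral_add iR₁ (hind.const_mul _),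
      integral_const_mul, integral_const_mul, integral_const_mul,
      integral_add (integrable_const 1) (iJ.div_const θ), integral_div, ← hJ, ← hK] at hle
    have h1 : ∫ _ : ℝ × ℝ, (1 : ℝ) ∂P = 1 := by simp
    rw [h1] at hle
    have := mul_le_mul_of_nonneg_left hM (show 0 ≤ 2 * τ ^ 2 by positivity)
    linarith
  have hfin : δ * (τ ^ 2 - σ ^ 2) < 2 * τ * M * (1 + C₃) + 2 * τ ^ 2 * (δ / 8) + 2 * K := by
    have : 2 * τ * M * (1 + J / θ) ≤ 2 * τ * M * (1 + C₃) := by gcongr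
    linarith
  have hbig : D < 3 / 4 * δ * τ := by
    have : 3 / 4 * δ * (1 + 4 / (3 * δ) * D) ≤ 3 / 4 * δ * τ := by gcongr
    have e : 3 / 4 * δ * (1 + 4 / (3 * δ) * D) = 3 / 4 * δ + D := by
      field_simp
    linarith
  have h1 : τ * D < τ * (3 / 4 * δ * τ) := mul_lt_mul_of_pos_left hbig hτ
  have h2 : 2 * K + δ * σ ^ 2 ≤ τ * (2 * K + δ * σ ^ 2) :=
    le_mul_of_one_le_left (by positivity) hτ1
  rw [hD] at h1
  linarith

/-- The reduced fixed-point system has a solution. -/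
theorem exists_fixedPoint {q : ℝ} {η : ℝ → ℝ → ℝ} (hq : 1 ≤ q)
    (hη : ∀ u χ, 0 ≤ χ → IsProx q χ u (η u χ)) {μB : Measure ℝ} [IsProbabilityMeasure μB]
    (hB : Integrable (fun b => b ^ 2) μB) {lam δ σ : ℝ} (hlam : 0 < lam) (hδ : 0 < δ)
    (hσ : 0 < σ) : ∃ τ > 0, ∃ θ > 0, errSq η μB τ θ = δ * (τ ^ 2 - σ ^ 2) ∧
      errCorr η μB τ θ = δ * (τ - lam / θ * τ) := by
  obtain ⟨g, hg⟩ := exists_continuousAt_implicit (f := dualGap η μB lam δ σ)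
    (fun τ hτ θ hθ => continuousAt_dualGap hq hη hB hτ hθ)
    (fun τ hτ => strictAntiOn_dualGap hq hη hB hlam hδ hτ)
    (fun τ hτ => exists_dualGap_pos hq hη hB hlam hδ hτ)
    (fun τ hτ => exists_dualGap_neg hq hη hB hδ hτ)
  obtain ⟨τ₀, hτ₀⟩ := exists_forall_errSq_le hq hη hB hlam hδ hσ
  set F : ℝ → ℝ := fun τ => δ * (τ ^ 2 - σ ^ 2) - errSq η μB τ (g τ) with hF
  have hFc : ContinuousOn F (Ioi 0) := fun τ hτ => by
    obtain ⟨hpos, -, hcont⟩ := hg τ hτ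
    have h := ContinuousAt.comp (f := fun t : ℝ => (t, g t))
      (continuousAt_errSq (τ := τ) hq hη hB hpos) (continuousAt_id.prodMk hcont)
    have h2 : ContinuousAt (fun t : ℝ => δ * (t ^ 2 - σ ^ 2)) τ := by fun_prop
    exact (h2.sub h).continuousWithinAt
  have hm : 0 < max τ₀ 1 := lt_max_of_lt_right one_pos
  have hlow : F σ ≤ 0 := by
    have := errSq_nonneg η μB σ (g σ)
    simp only [hF, sub_self, mul_zero]
    linarith
  have hhigh : 0 ≤ F (max τ₀ 1) := by
    have := hτ₀ _ (le_max_left τ₀ 1) hm _ (hg _ hm).1 (hg _ hm).2.1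
    simp only [hF]
    linarith
  obtain ⟨τ, hτ, hτ0⟩ := isPreconnected_Ioi.intermediate_value (Set.mem_Ioi.2 hσ)
    (Set.mem_Ioi.2 hm) hFc ⟨hlow, hhigh⟩
  rw [Set.mem_Ioi] at hτ
  obtain ⟨hθ, hgap, -⟩ := hg τ hτ
  have hS : errSq η μB τ (g τ) = δ * (τ ^ 2 - σ ^ 2) := by
    simp only [hF] at hτ0
    linarith
  refine ⟨τ, hτ, g τ, hθ, hS, ?_⟩
  rw [dualGap, hS] at hgap
  have hcancel : 2 * τ * (g τ * errCorr η μB τ (g τ))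
      = 2 * τ * (τ * δ * (g τ - lam)) := by
    field_simp at hgap
    linarith
  have hcancel' := mul_left_cancel₀ (by positivity) hcancel
  field_simp
  linarith

/-- For any `λ > 0`, `δ > 0`, `σ_w > 0`, `q ∈ [1,2]`, and any random variable `B`
(with law `μB`) with `E[B²] < ∞`, independent of `Z ~ N(0,1)`, there exists a unique pair
`(σ̄, χ̄)`, `σ̄ > 0`, `χ̄ ≥ 0`, satisfying the fixed-point equations
`σ̄² = σ_w² + (1/δ)·E[(η_q(B+σ̄Z;χ̄σ̄^{2−q}) − B)²]` and
`λ = χ̄σ̄^{2−q}(1 − (1/δ)·E[∂₁η_q(B+σ̄Z;χ̄σ̄^{2−q})])`; here `η'` denotes the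
derivative of `η_q` with respect to its first argument (for `q = 1`, the a.e.
derivative `1{|u|>χ}`). -/
theorem unique_fixed_point_pair
    (lam δ σw q : ℝ) (hlam : 0 < lam) (hδ : 0 < δ) (hσw : 0 < σw)
    (hq1 : 1 ≤ q) (hq2 : q ≤ 2)
    (μB : Measure ℝ) [IsProbabilityMeasure μB]
    (hB : Integrable (fun b => b^2) μB)
    (η η' : ℝ → ℝ → ℝ)
    (hη : ∀ u χ, 0 ≤ χ → IsProx q χ u (η u χ))
    (hη'1 : q = 1 → ∀ u χ, 0 ≤ χ → η' u χ = if χ < |u| then 1 else 0)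
    (hη'q : 1 < q → ∀ u χ, 0 < χ → HasDerivAt (fun v => η v χ) (η' u χ) u) :
    ∃! p : ℝ × ℝ, 0 < p.1 ∧ 0 ≤ p.2 ∧
      p.1 ^ 2 = σw ^ 2 + (1/δ) *
        ∫ b, (∫ z, (η (b + p.1 * z) (p.2 * p.1 ^ (2 - q)) - b)^2 ∂stdGaussian) ∂μB ∧
      lam = p.2 * p.1 ^ (2 - q) *
        (1 - (1/δ) *
          ∫ b, (∫ z, η' (b + p.1 * z) (p.2 * p.1 ^ (2 - q)) ∂stdGaussian) ∂μB) := by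
  have key : ∀ σ χ : ℝ, 0 < σ → 0 ≤ χ →
      ((σ ^ 2 = σw ^ 2 + (1/δ) *
        ∫ b, (∫ z, (η (b + σ * z) (χ * σ ^ (2 - q)) - b)^2 ∂stdGaussian) ∂μB ∧
      lam = χ * σ ^ (2 - q) *
        (1 - (1/δ) *
          ∫ b, (∫ z, η' (b + σ * z) (χ * σ ^ (2 - q)) ∂stdGaussian) ∂μB)) ↔
      0 < χ * σ ^ (2 - q) ∧
      errSq η μB σ (χ * σ ^ (2 - q)) = δ * (σ ^ 2 - σw ^ 2) ∧
      errCorr η μB σ (χ * σ ^ (2 - q)) = δ * (σ - lam / (χ * σ ^ (2 - q)) * σ)) := by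
    intro σ χ hσ hχ
    have hθ0 : 0 ≤ χ * σ ^ (2 - q) := mul_nonneg hχ (Real.rpow_nonneg hσ.le _)
    generalize χ * σ ^ (2 - q) = θ at hθ0 ⊢
    rcases hθ0.eq_or_lt with rfl | hθ
    · simp [hlam.ne']
    · rw [integral_integral_sq_eq_errSq hq1 hη hB hθ,
        ← mul_integral_integral_proxDeriv_eq_errCorr hq1 hη hη'1 hη'q hB hσ hθ]
      generalize ∫ b, (∫ z, η' (b + σ * z) θ ∂_root_.stdGaussian) ∂μB = I
      generalize errSq η μB σ θ = S
      refine ⟨fun ⟨h1, h2⟩ => ⟨hθ, ?_, ?_⟩, fun ⟨_, h1, h2⟩ => ⟨?_, ?_⟩⟩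
      · rw [h1]
        field_simp
        ring
      · rw [h2]
        field_simp
        ring
      · rw [h1]
        field_simp
        ring
      · field_simp at h2 ⊢
        linarith
  obtain ⟨τ, hτ, θ, hθ, hS, hT⟩ := exists_fixedPoint hq1 hη hB hlam hδ hσw
  have hpow : ∀ σ : ℝ, 0 < σ → 0 < σ ^ (2 - q) := fun σ hσ => Real.rpow_pos_of_pos hσ _
  have hcancel : θ / τ ^ (2 - q) * τ ^ (2 - q) = θ := div_mul_cancel₀ _ (hpow τ hτ).ne'
  refine ⟨(τ, θ / τ ^ (2 - q)), ⟨hτ, (div_pos hθ (hpow τ hτ)).le, ?_⟩, ?_⟩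
  · refine (key τ _ hτ (div_pos hθ (hpow τ hτ)).le).2 ?_
    rw [hcancel]
    exact ⟨hθ, hS, hT⟩
  · rintro ⟨σ, χ⟩ ⟨hσ, hχ, h⟩
    obtain ⟨hpos, hS', hT'⟩ := (key σ χ hσ hχ).1 h
    obtain ⟨e₁, e₂⟩ := fixedPoint_unique hq1 hη hB hlam hδ hσw hσ hτ hpos hθ hS' hS hT' hT
    simp only at hσ
    subst e₁
    rw [← e₂, mul_div_cancel_right₀ _ (hpow σ hσ).ne']
end
end

section
/- Suppose P(|G| ≤ t) = O(t) as t → 0 and E[G²] < ∞. Then for every q ∈ (1,2), δ > 1 and ε ∈ (0,1), as σ_w → 0: AMSE(σ_w) = σ_w²/(1 − 1/δ) − [δ^{q+1}(1−ε)²(E|Z|^q)² / ((δ−1)^{q+1} · ε · E|G|^{2q−2})] · σ_w^{2q} + o(σ_w^{2q}). -/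
open MeasureTheory ProbabilityTheory Real Filter Set Asymptotics

noncomputable section

/-- The law of `B`: the mixture `(1−ε)δ₀ + ε·g`. -/
def mix (ε : ℝ) (g : Measure ℝ) : Measure ℝ :=
  ENNReal.ofReal (1 - ε) • Measure.dirac (0:ℝ) + ENNReal.ofReal ε • g

/-- `min_{χ ≥ 0} E[(η(B+σZ;χ) − B)²]` where `B ~ μB`, `Z ~ N(0,1)` independent. -/
def riskMin (η : ℝ → ℝ → ℝ) (μB : Measure ℝ) (σ : ℝ) : ℝ :=
  ⨅ χ : NNReal, ∫ b, (∫ z, (η (b + σ * z) (χ:ℝ) - b)^2 ∂stdGaussian) ∂μB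

/-- The signed power `sign x * |x| ^ (q - 1)`, which is the derivative of `|x| ^ q / q`. -/
def signedPow (q x : ℝ) : ℝ := |x| ^ (q - 2) * x

lemma signedPow_of_nonneg {q x : ℝ} (hq : 1 < q) (hx : 0 ≤ x) :
    signedPow q x = x ^ (q - 1) := by
  rcases hx.eq_or_lt with rfl | hx
  · simp [signedPow, Real.zero_rpow (by linarith : q - 1 ≠ 0)]
  · rw [signedPow, abs_of_pos hx, show q - 1 = q - 2 + 1 by ring, Real.rpow_add_one hx.ne']

lemma signedPow_neg (q x : ℝ) : signedPow q (-x) = -signedPow q x := by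
  simp [signedPow]

lemma abs_signedPow {q : ℝ} (hq : 1 < q) (x : ℝ) : |signedPow q x| = |x| ^ (q - 1) := by
  rw [← signedPow_of_nonneg hq (abs_nonneg x), signedPow, signedPow, abs_mul, abs_abs,
    abs_of_nonneg (Real.rpow_nonneg (abs_nonneg x) _)]

lemma signedPow_mul_self {q : ℝ} (hq : 1 < q) (x : ℝ) : signedPow q x * x = |x| ^ q := by
  have h : signedPow q x * x = signedPow q |x| * |x| := by
    rw [signedPow, signedPow, abs_abs, mul_assoc, mul_assoc, abs_mul_abs_self]
  rw [h, signedPow_of_nonneg hq (abs_nonneg x)]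
  rcases (abs_nonneg x).eq_or_lt with h0 | h0
  · rw [← h0, Real.zero_rpow (by linarith : q ≠ 0), mul_zero]
  · rw [← Real.rpow_add_one h0.ne']
    ring_nf

lemma signedPow_sq {q : ℝ} (hq : 1 < q) (x : ℝ) :
    signedPow q x ^ 2 = |x| ^ (2 * q - 2) := by
  rw [← sq_abs, abs_signedPow hq, ← Real.rpow_mul_natCast (abs_nonneg x)]
  congr 1
  push_cast
  ring

lemma abs_signedPow_le {q x y : ℝ} (hq : 1 < q) (h : |x| ≤ |y|) :
    |signedPow q x| ≤ |signedPow q y| := by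
  rw [abs_signedPow hq, abs_signedPow hq]
  exact Real.rpow_le_rpow (abs_nonneg x) h (by linarith)

lemma signedPow_sq_le {q : ℝ} (hq1 : 1 < q) (hq2 : q < 2) (x : ℝ) :
    signedPow q x ^ 2 ≤ 1 + x ^ 2 := by
  rw [signedPow_sq hq1]
  rcases le_total |x| 1 with h | h
  · have := Real.rpow_le_one (abs_nonneg x) h (by linarith : 0 ≤ 2 * q - 2)
    nlinarith [sq_nonneg x]
  · have := Real.rpow_le_rpow_of_exponent_le h (by linarith : 2 * q - 2 ≤ 2)
    rw [Real.rpow_two, sq_abs] at this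
    linarith

lemma signedPow_mul_of_pos {q c : ℝ} (hq : 1 < q) (hc : 0 < c) (x : ℝ) :
    signedPow q (c * x) = c ^ (q - 1) * signedPow q x := by
  rw [← signedPow_of_nonneg hq hc.le, signedPow, signedPow, signedPow, abs_mul,
    Real.mul_rpow (abs_nonneg c) (abs_nonneg x)]
  ring

lemma signedPow_mono {q : ℝ} (hq : 1 < q) : Monotone (signedPow q) := by
  intro x y h
  rcases le_total 0 x with hx | hx
  · rw [signedPow_of_nonneg hq hx, signedPow_of_nonneg hq (hx.trans h)]
    exact Real.rpow_le_rpow hx h (by linarith)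
  · rw [← neg_neg x, signedPow_neg, signedPow_of_nonneg hq (neg_nonneg.2 hx)]
    rcases le_total 0 y with hy | hy
    · rw [signedPow_of_nonneg hq hy]
      have h1 := Real.rpow_nonneg hy (q - 1)
      have h2 := Real.rpow_nonneg (neg_nonneg.2 hx) (q - 1)
      linarith
    · rw [← neg_neg y, signedPow_neg, signedPow_of_nonneg hq (neg_nonneg.2 hy)]
      exact neg_le_neg (Real.rpow_le_rpow (by linarith) (by linarith) (by linarith))

lemma abs_signedPow_sub_le {q : ℝ} (hq1 : 1 < q) (hq2 : q < 2) (x y : ℝ) :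
    |signedPow q x - signedPow q y| ≤ 2 * |x - y| ^ (q - 1) := by
  have hpos : ∀ {a b : ℝ}, 0 ≤ b → b ≤ a →
      signedPow q a - signedPow q b ≤ 2 * (a - b) ^ (q - 1) := by
    intro a b hb hab
    rw [signedPow_of_nonneg hq1 hb, signedPow_of_nonneg hq1 (hb.trans hab)]
    have h := Real.rpow_add_le_add_rpow (sub_nonneg.2 hab) hb (by linarith : 0 ≤ q - 1)
      (by linarith)
    rw [sub_add_cancel] at h
    have := Real.rpow_nonneg (sub_nonneg.2 hab) (q - 1)
    linarith
  have key : ∀ {a b : ℝ}, b ≤ a → signedPow q a - signedPow q b ≤ 2 * (a - b) ^ (q - 1) := by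
    intro a b hab
    rcases le_total 0 b with hb | hb
    · exact hpos hb hab
    · rcases le_total 0 a with ha | ha
      · rw [← neg_neg b, signedPow_neg, signedPow_of_nonneg hq1 (neg_nonneg.2 hb),
          signedPow_of_nonneg hq1 ha, neg_neg]
        have h1 : a ^ (q - 1) ≤ (a - b) ^ (q - 1) :=
          Real.rpow_le_rpow ha (by linarith) (by linarith)
        have h2 : (-b) ^ (q - 1) ≤ (a - b) ^ (q - 1) :=
          Real.rpow_le_rpow (by linarith) (by linarith) (by linarith)
        linarith
      · have := hpos (neg_nonneg.2 ha) (neg_le_neg hab)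
        rw [signedPow_neg, signedPow_neg, neg_sub_neg, neg_sub_neg] at this
        exact this
  rcases le_total y x with h | h
  · rw [abs_of_nonneg (sub_nonneg.2 (signedPow_mono hq1 h)), abs_of_nonneg (sub_nonneg.2 h)]
    exact key h
  · rw [abs_sub_comm, abs_sub_comm x y, abs_of_nonneg (sub_nonneg.2 (signedPow_mono hq1 h)),
      abs_of_nonneg (sub_nonneg.2 h)]
    exact key h

lemma continuous_signedPow {q : ℝ} (hq1 : 1 < q) (hq2 : q < 2) : Continuous (signedPow q) := by
  rw [continuous_iff_continuousAt]
  intro x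
  rw [ContinuousAt, tendsto_iff_dist_tendsto_zero]
  have h : Tendsto (fun y => 2 * |y - x| ^ (q - 1)) (nhds x) (nhds (2 * |x - x| ^ (q - 1))) :=
    Continuous.tendsto (continuous_const.mul
      ((continuous_id.sub continuous_const).abs.rpow_const fun _ => Or.inr (by linarith))) x
  rw [sub_self, abs_zero, Real.zero_rpow (by linarith), mul_zero] at h
  exact squeeze_zero (fun _ => dist_nonneg) (fun y => abs_signedPow_sub_le hq1 hq2 y x) h

lemma signedPow_isBigO_sub (q : ℝ) {b : ℝ} (hb : b ≠ 0) :
    (fun p : ℝ × ℝ => signedPow q p.1 - signedPow q p.2) =O[nhds (b, b)]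
      fun p => p.1 - p.2 := by
  have h : ContDiffAt ℝ 1 (signedPow q) b :=
    ((contDiffAt_abs hb).rpow_const_of_ne (abs_ne_zero.2 hb)).mul contDiffAt_id
  exact (h.hasStrictFDerivAt one_ne_zero).isBigO_sub

section Prox

variable {q : ℝ}

lemma IsProx.sub_eq {χ u v : ℝ} (hq : 1 < q) (h : IsProx q χ u v) :
    u - v = χ * q * signedPow q v := by
  have hmin : IsLocalMin (fun z : ℝ => (1 / 2) * (u - z) ^ 2 + χ * |z| ^ q) v :=
    Filter.Eventually.of_forall h
  have hd := ((((hasDerivAt_id v).const_sub u).pow 2).const_mul (1 / 2 : ℝ)).add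
    ((hasDerivAt_abs_rpow v hq).const_mul χ)
  have := hmin.hasDerivAt_eq_zero hd
  simp only [id, signedPow] at this ⊢
  norm_num at this
  linarith

variable {η : ℝ → ℝ → ℝ} (hη : ∀ u χ, 0 ≤ χ → IsProx q χ u (η u χ))

include hη

lemma abs_prox_sub_le (hq : 1 < q) {χ : ℝ} (hχ : 0 ≤ χ) (u w : ℝ) :
    |η u χ - η w χ| ≤ |u - w| := by
  have h1 := (hη u χ hχ).sub_eq hq
  have h2 := (hη w χ hχ).sub_eq hq
  have hm : 0 ≤ (signedPow q (η u χ) - signedPow q (η w χ)) * (η u χ - η w χ) := by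
    rcases le_total (η u χ) (η w χ) with h | h
    · exact mul_nonneg_of_nonpos_of_nonpos (sub_nonpos.2 (signedPow_mono hq h)) (sub_nonpos.2 h)
    · exact mul_nonneg (sub_nonneg.2 (signedPow_mono hq h)) (sub_nonneg.2 h)
  have h3 : (η u χ - η w χ) ^ 2 ≤ (u - w) * (η u χ - η w χ) := by
    have : (u - w) * (η u χ - η w χ) = (η u χ - η w χ) ^ 2 + χ * q *
        ((signedPow q (η u χ) - signedPow q (η w χ)) * (η u χ - η w χ)) := by
      linear_combination (η u χ - η w χ) * (h1 - h2)
    have h4 : 0 ≤ χ * q := mul_nonneg hχ (by linarith)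
    nlinarith [mul_nonneg h4 hm]
  rw [← sq_abs] at h3
  have h4 := (le_abs_self _).trans_eq (abs_mul (u - w) (η u χ - η w χ))
  rcases (abs_nonneg (η u χ - η w χ)).eq_or_lt with h | h
  · rw [← h]
    exact abs_nonneg _
  · nlinarith

lemma prox_zero (hq : 1 < q) {χ : ℝ} (hχ : 0 ≤ χ) : η 0 χ = 0 := by
  have h := (hη 0 χ hχ).sub_eq hq
  have h1 := signedPow_mul_self hq (η 0 χ)
  have h2 : 0 ≤ |η 0 χ| ^ q := Real.rpow_nonneg (abs_nonneg _) _
  have h3 : 0 ≤ χ * q := mul_nonneg hχ (by linarith)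
  have h4 : (η 0 χ) ^ 2 = -(χ * q * |η 0 χ| ^ q) := by
    rw [← h1]
    linear_combination (-(η 0 χ)) * h
  nlinarith [mul_nonneg h3 h2, sq_nonneg (η 0 χ)]

lemma abs_prox_le (hq : 1 < q) {χ : ℝ} (hχ : 0 ≤ χ) (u : ℝ) : |η u χ| ≤ |u| := by
  simpa [prox_zero hη hq hχ] using abs_prox_sub_le hη hq hχ u 0

lemma continuous_prox (hq : 1 < q) {χ : ℝ} (hχ : 0 ≤ χ) : Continuous fun u => η u χ := by
  refine (LipschitzWith.of_dist_le_mul (K := 1) fun u w => ?_).continuous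
  simpa [Real.dist_eq] using abs_prox_sub_le hη hq hχ u w

lemma abs_sub_prox_le (hq : 1 < q) {χ : ℝ} (hχ : 0 ≤ χ) (u : ℝ) :
    |u - η u χ| ≤ χ * q * |u| ^ (q - 1) := by
  have h3 : 0 ≤ χ * q := mul_nonneg hχ (by linarith)
  rw [(hη u χ hχ).sub_eq hq, abs_mul, abs_of_nonneg h3, abs_signedPow hq]
  exact mul_le_mul_of_nonneg_left
    (Real.rpow_le_rpow (abs_nonneg _) (abs_prox_le hη hq hχ u) (by linarith)) h3

lemma prox_zero_penalty (hq : 1 < q) (u : ℝ) : η u 0 = u := by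
  have := (hη u 0 le_rfl).sub_eq hq
  linarith

/-- The shrinkage `u - η u χ` grows in absolute value with the penalty `χ`. -/
lemma abs_sub_prox_mono {χ χ' : ℝ} (hχ : 0 ≤ χ) (h : χ ≤ χ') (u : ℝ) :
    |u - η u χ| ≤ |u - η u χ'| := by
  by_contra! hlt
  have h1 := hη u χ hχ (η u χ')
  have h2 := hη u χ' (hχ.trans h) (η u χ)
  have hsq := sq_lt_sq.2 hlt
  rcases h.eq_or_lt with rfl | h
  · exact hlt.false
  rcases lt_or_ge (|η u χ| ^ q) (|η u χ'| ^ q) with h3 | h3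
  · nlinarith [mul_pos (sub_pos.2 h) (sub_pos.2 h3)]
  · nlinarith

end Prox

section GaussianMoments

instance inst_s3 : IsProbabilityMeasure stdGaussian := by
  unfold _root_.stdGaussian
  infer_instance

lemma integral_id_stdGaussian : ∫ z, z ∂stdGaussian = 0 :=
  integral_id_gaussianReal

lemma integrable_sq_stdGaussian : Integrable (fun z : ℝ => z ^ 2) stdGaussian :=
  (memLp_id_gaussianReal (μ := 0) (v := 1) 2).integrable_sq

lemma integral_sq_stdGaussian : ∫ z, z ^ 2 ∂stdGaussian = 1 := by
  have h := variance_eq_sub (memLp_id_gaussianReal (μ := 0) (v := 1) 2)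
  rw [variance_id_gaussianReal] at h
  have h0 : ∫ z, id z ∂gaussianReal 0 1 = 0 := integral_id_gaussianReal
  rw [h0] at h
  simpa [_root_.stdGaussian] using h.symm

lemma integrable_abs_rpow {μ : Measure ℝ} [IsFiniteMeasure μ]
    (hμ : Integrable (fun x : ℝ => x ^ 2) μ) {p : ℝ} (hp0 : 0 ≤ p) (hp2 : p ≤ 2) :
    Integrable (fun x : ℝ => |x| ^ p) μ := by
  refine ((integrable_const (1 : ℝ)).add hμ).mono'
    (continuous_abs.rpow_const fun _ => Or.inr hp0).aestronglyMeasurable (ae_of_all _ fun x => ?_)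
  rw [Real.norm_of_nonneg (Real.rpow_nonneg (abs_nonneg x) p)]
  simp only [Pi.add_apply]
  rcases le_total |x| 1 with h | h
  · have := Real.rpow_le_one (abs_nonneg x) h hp0
    nlinarith [sq_nonneg x]
  · have := Real.rpow_le_rpow_of_exponent_le h hp2
    rw [Real.rpow_two, sq_abs] at this
    linarith

lemma ae_ne_zero {μ : Measure ℝ} (hμ0 : μ {0} = 0) : ∀ᵐ b ∂μ, b ≠ 0 := by
  rw [ae_iff]
  simpa using hμ0

lemma ae_fst_ne_zero {μ : Measure ℝ} (hμ0 : μ {0} = 0) :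
    ∀ᵐ p : ℝ × ℝ ∂μ.prod stdGaussian, p.1 ≠ 0 :=
  Measure.quasiMeasurePreserving_fst.ae (ae_ne_zero hμ0)

lemma integral_snd_sq {μ : Measure ℝ} [IsProbabilityMeasure μ] :
    ∫ p : ℝ × ℝ, p.2 ^ 2 ∂μ.prod stdGaussian = 1 := by
  rw [integral_fun_snd (fun z : ℝ => z ^ 2), integral_sq_stdGaussian]
  simp

end GaussianMoments

section Risk

variable {q : ℝ} {η : ℝ → ℝ → ℝ} (hη : ∀ u χ, 0 ≤ χ → IsProx q χ u (η u χ))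
  {μ : Measure ℝ} [IsProbabilityMeasure μ] (hμ : Integrable (fun x : ℝ => x ^ 2) μ)

include hη in
lemma continuous_signedPow_prox (hq1 : 1 < q) (hq2 : q < 2) {χ : ℝ} (hχ : 0 ≤ χ) (σ : ℝ) :
    Continuous fun p : ℝ × ℝ => signedPow q (η (p.1 + σ * p.2) χ) :=
  (continuous_signedPow hq1 hq2).comp ((continuous_prox hη hq1 hχ).comp (by fun_prop))

include hη in
lemma signedPow_prox_sq_le (hq1 : 1 < q) (hq2 : q < 2) {χ : ℝ} (hχ : 0 ≤ χ) (σ b z : ℝ) :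
    signedPow q (η (b + σ * z) χ) ^ 2 ≤ 1 + (2 * b ^ 2 + 2 * σ ^ 2 * z ^ 2) := by
  have h1 := signedPow_sq_le hq1 hq2 (η (b + σ * z) χ)
  have h2 := sq_le_sq.2 (abs_prox_le hη hq1 hχ (b + σ * z))
  nlinarith [sq_nonneg (b - σ * z)]

include hμ in
lemma integrable_sq_add_sq (c d e : ℝ) :
    Integrable (fun p : ℝ × ℝ => c + (d * p.1 ^ 2 + e * p.2 ^ 2)) (μ.prod stdGaussian) :=
  (integrable_const c).add (((hμ.comp_fst stdGaussian).const_mul d).add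
    ((integrable_sq_stdGaussian.comp_snd μ).const_mul e))

include hη hμ in
lemma integrable_signedPow_prox_sq (hq1 : 1 < q) (hq2 : q < 2) {χ : ℝ} (hχ : 0 ≤ χ) (σ : ℝ) :
    Integrable (fun p : ℝ × ℝ => signedPow q (η (p.1 + σ * p.2) χ) ^ 2)
      (μ.prod stdGaussian) := by
  refine (integrable_sq_add_sq hμ 1 2 (2 * σ ^ 2)).mono'
    ((continuous_signedPow_prox hη hq1 hq2 hχ σ).pow 2).aestronglyMeasurable
    (ae_of_all _ fun p => ?_)
  rw [Real.norm_of_nonneg (sq_nonneg _)]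
  exact signedPow_prox_sq_le hη hq1 hq2 hχ σ p.1 p.2

include hη hμ in
lemma integrable_mul_signedPow_prox (hq1 : 1 < q) (hq2 : q < 2) {χ : ℝ} (hχ : 0 ≤ χ) (σ : ℝ) :
    Integrable (fun p : ℝ × ℝ => p.2 * signedPow q (η (p.1 + σ * p.2) χ))
      (μ.prod stdGaussian) := by
  refine ((integrable_sq_stdGaussian.comp_snd μ).add
    (integrable_signedPow_prox_sq hη hμ hq1 hq2 hχ σ)).mono'
    (continuous_snd.mul (continuous_signedPow_prox hη hq1 hq2 hχ σ)).aestronglyMeasurable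
    (ae_of_all _ fun p => ?_)
  rw [Real.norm_eq_abs, abs_mul]
  simp only [Pi.add_apply]
  nlinarith [sq_nonneg (|p.2| - |signedPow q (η (p.1 + σ * p.2) χ)|), sq_abs p.2,
    sq_abs (signedPow q (η (p.1 + σ * p.2) χ)), sq_nonneg p.2,
    sq_nonneg (signedPow q (η (p.1 + σ * p.2) χ))]

include hη in
lemma prox_error_sq (hq1 : 1 < q) {χ : ℝ} (hχ : 0 ≤ χ) (σ b z : ℝ) :
    (η (b + σ * z) χ - b) ^ 2 = σ ^ 2 * z ^ 2
      - 2 * q * χ * σ * (z * signedPow q (η (b + σ * z) χ))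
      + q ^ 2 * χ ^ 2 * signedPow q (η (b + σ * z) χ) ^ 2 := by
  have h := (hη (b + σ * z) χ hχ).sub_eq hq1
  have h1 : η (b + σ * z) χ - b = σ * z - χ * q * signedPow q (η (b + σ * z) χ) := by
    linarith
  rw [h1]
  ring

include hη hμ in
lemma integrable_prox_error_sq (hq1 : 1 < q) (hq2 : q < 2) {χ : ℝ} (hχ : 0 ≤ χ) (σ : ℝ) :
    Integrable (fun p : ℝ × ℝ => (η (p.1 + σ * p.2) χ - p.1) ^ 2) (μ.prod stdGaussian) := by
  simp only [prox_error_sq hη hq1 hχ]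
  exact (((integrable_sq_stdGaussian.comp_snd μ).const_mul _).sub
    ((integrable_mul_signedPow_prox hη hμ hq1 hq2 hχ σ).const_mul _)).add
    ((integrable_signedPow_prox_sq hη hμ hq1 hq2 hχ σ).const_mul _)

include hη hμ in
/-- Expansion of the square `(η - b)² = (σ z - χ q · signedPow q η)²` under the integral. -/
lemma integral_prox_error_sq (hq1 : 1 < q) (hq2 : q < 2) {χ : ℝ} (hχ : 0 ≤ χ) (σ : ℝ) :
    ∫ p : ℝ × ℝ, (η (p.1 + σ * p.2) χ - p.1) ^ 2 ∂μ.prod stdGaussian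
      = σ ^ 2
        - 2 * q * χ * σ *
          ∫ p : ℝ × ℝ, p.2 * signedPow q (η (p.1 + σ * p.2) χ) ∂μ.prod stdGaussian
        + q ^ 2 * χ ^ 2 *
          ∫ p : ℝ × ℝ, signedPow q (η (p.1 + σ * p.2) χ) ^ 2 ∂μ.prod stdGaussian := by
  have hz := (integrable_sq_stdGaussian.comp_snd μ).const_mul (σ ^ 2)
  have h1 := (integrable_mul_signedPow_prox hη hμ hq1 hq2 hχ σ).const_mul (2 * q * χ * σ)
  have h2 := (integrable_signedPow_prox_sq hη hμ hq1 hq2 hχ σ).const_mul (q ^ 2 * χ ^ 2)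
  simp only [prox_error_sq hη hq1 hχ]
  rw [integral_add (by exact hz.sub h1) h2, integral_sub hz h1, integral_const_mul, integral_const_mul,
    integral_const_mul, integral_snd_sq, mul_one]

include hη in
/-- The risk splits into the contributions of the point mass at `0` and of `μ`. -/
lemma integral_mix_eq (hμ : Integrable (fun x : ℝ => x ^ 2) μ) (hq1 : 1 < q) (hq2 : q < 2)
    {ε χ : ℝ} (hε0 : 0 ≤ ε) (hε1 : ε ≤ 1) (hχ : 0 ≤ χ) (σ : ℝ) :
    ∫ b, (∫ z, (η (b + σ * z) χ - b) ^ 2 ∂stdGaussian) ∂mix ε μ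
      = (1 - ε) * (∫ z, η (σ * z) χ ^ 2 ∂stdGaussian)
        + ε * ∫ p : ℝ × ℝ, (η (p.1 + σ * p.2) χ - p.1) ^ 2 ∂μ.prod stdGaussian := by
  have hint := integrable_prox_error_sq hη hμ hq1 hq2 hχ σ
  have hd : Integrable (fun b => ∫ z, (η (b + σ * z) χ - b) ^ 2 ∂stdGaussian)
      (Measure.dirac (0 : ℝ)) := integrable_dirac (by simp)
  rw [mix, integral_add_measure (hd.smul_measure ENNReal.ofReal_ne_top)
    (hint.integral_prod_left.smul_measure ENNReal.ofReal_ne_top), integral_smul_measure,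
    integral_smul_measure, integral_dirac, integral_prod _ hint,
    ENNReal.toReal_ofReal (by linarith), ENNReal.toReal_ofReal hε0]
  simp

include hη in
lemma integral_prox_sq (hq1 : 1 < q) (hq2 : q < 2) {χ : ℝ} (hχ : 0 ≤ χ) (σ : ℝ) :
    ∫ z, η (σ * z) χ ^ 2 ∂stdGaussian
      = σ ^ 2 - 2 * q * χ * σ * (∫ z, z * signedPow q (η (σ * z) χ) ∂stdGaussian)
        + q ^ 2 * χ ^ 2 * ∫ z, signedPow q (η (σ * z) χ) ^ 2 ∂stdGaussian := by
  have hμ : Integrable (fun x : ℝ => x ^ 2) (Measure.dirac (0 : ℝ)) := integrable_dirac (by simp)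
  have h := integral_prox_error_sq hη hμ hq1 hq2 hχ σ
  rw [integral_prod _ (integrable_prox_error_sq hη hμ hq1 hq2 hχ σ),
    integral_prod _ (integrable_mul_signedPow_prox hη hμ hq1 hq2 hχ σ),
    integral_prod _ (integrable_signedPow_prox_sq hη hμ hq1 hq2 hχ σ)] at h
  simpa using h

end Risk

section Limits

variable {q : ℝ} {η : ℝ → ℝ → ℝ} (hη : ∀ u χ, 0 ≤ χ → IsProx q χ u (η u χ))
  {μ : Measure ℝ} [IsProbabilityMeasure μ] (hμ : Integrable (fun x : ℝ => x ^ 2) μ)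
  {χ : ℝ → ℝ} (hχ0 : ∀ σ, 0 ≤ χ σ)

include hη hχ0 in
lemma tendsto_prox (hq1 : 1 < q) (hχ : Tendsto χ (nhdsWithin 0 (Ioi 0)) (nhds 0)) (b z : ℝ) :
    Tendsto (fun σ => η (b + σ * z) (χ σ)) (nhdsWithin 0 (Ioi 0)) (nhds b) := by
  have hid : Tendsto (fun σ : ℝ => σ) (nhdsWithin 0 (Ioi 0)) (nhds 0) :=
    tendsto_id.mono_left nhdsWithin_le_nhds
  have hu : Tendsto (fun σ : ℝ => b + σ * z) (nhdsWithin 0 (Ioi 0)) (nhds b) := by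
    simpa using (hid.mul_const z).const_add b
  have hD : Tendsto (fun σ => (b + σ * z) - η (b + σ * z) (χ σ)) (nhdsWithin 0 (Ioi 0))
      (nhds 0) := by
    refine squeeze_zero_norm (fun σ => abs_sub_prox_le hη hq1 (hχ0 σ) _) ?_
    simpa using (hχ.mul_const q).mul
      (hu.abs.rpow_const (p := q - 1) (Or.inr (by linarith)))
  simpa using hu.sub hD

include hη hμ hχ0 in
lemma tendsto_integral_signedPow_prox_sq (hq1 : 1 < q) (hq2 : q < 2)
    (hχ : Tendsto χ (nhdsWithin 0 (Ioi 0)) (nhds 0)) :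
    Tendsto (fun σ => ∫ p : ℝ × ℝ, signedPow q (η (p.1 + σ * p.2) (χ σ)) ^ 2
      ∂μ.prod stdGaussian) (nhdsWithin 0 (Ioi 0)) (nhds (∫ x, |x| ^ (2 * q - 2) ∂μ)) := by
  have hlim : ∫ x, |x| ^ (2 * q - 2) ∂μ
      = ∫ p : ℝ × ℝ, signedPow q p.1 ^ 2 ∂μ.prod stdGaussian := by
    rw [integral_fun_fst (fun x : ℝ => signedPow q x ^ 2)]
    simp [signedPow_sq hq1]
  rw [hlim]
  refine tendsto_integral_filter_of_dominated_convergence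
    (fun p => 1 + (2 * p.1 ^ 2 + 2 * p.2 ^ 2))
    (Eventually.of_forall fun σ =>
      ((continuous_signedPow_prox hη hq1 hq2 (hχ0 σ) σ).pow 2).aestronglyMeasurable)
    ?_ (integrable_sq_add_sq hμ 1 2 2) (ae_of_all _ fun p => ?_)
  · filter_upwards [Ioo_mem_nhdsGT (one_pos : (0 : ℝ) < 1)] with σ hσ
    refine ae_of_all _ fun p => ?_
    rw [Real.norm_of_nonneg (sq_nonneg _)]
    refine (signedPow_prox_sq_le hη hq1 hq2 (hχ0 σ) σ p.1 p.2).trans ?_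
    have : σ ^ 2 ≤ 1 := by nlinarith [hσ.1, hσ.2]
    nlinarith [sq_nonneg p.2]
  · exact (((continuous_signedPow hq1 hq2).tendsto _).comp
      (tendsto_prox hη hχ0 hq1 hχ p.1 p.2)).pow 2

include hη hμ hχ0 in
lemma tendsto_integral_mul_signedPow_prox (hμ0 : μ {0} = 0) (hq1 : 1 < q) (hq2 : q < 2)
    (hχ : Tendsto χ (nhdsWithin 0 (Ioi 0)) (nhds 0)) :
    Tendsto (fun σ => (∫ p : ℝ × ℝ, p.2 * signedPow q (η (p.1 + σ * p.2) (χ σ))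
      ∂μ.prod stdGaussian) / σ ^ (q - 1)) (nhdsWithin 0 (Ioi 0)) (nhds 0) := by
  have hcenter : ∀ σ, (∫ p : ℝ × ℝ, p.2 * signedPow q (η (p.1 + σ * p.2) (χ σ))
      ∂μ.prod stdGaussian) / σ ^ (q - 1)
      = ∫ p : ℝ × ℝ, p.2 * ((signedPow q (η (p.1 + σ * p.2) (χ σ))
        - signedPow q (η p.1 (χ σ))) / σ ^ (q - 1)) ∂μ.prod stdGaussian := by
    intro σ
    have h0 : ∫ p : ℝ × ℝ, p.2 * signedPow q (η p.1 (χ σ)) ∂μ.prod stdGaussian = 0 := by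
      have h := integral_prod_mul (μ := μ) (ν := stdGaussian)
        (fun b => signedPow q (η b (χ σ))) (fun z => z)
      rw [integral_id_stdGaussian, mul_zero] at h
      simpa only [mul_comm] using h
    have hi0 : Integrable (fun p : ℝ × ℝ => p.2 * signedPow q (η p.1 (χ σ)))
        (μ.prod stdGaussian) := by
      simpa using integrable_mul_signedPow_prox hη hμ hq1 hq2 (hχ0 σ) 0
    have hi := integrable_mul_signedPow_prox hη hμ hq1 hq2 (hχ0 σ) σ
    rw [← sub_zero (∫ p : ℝ × ℝ, p.2 * signedPow q (η (p.1 + σ * p.2) (χ σ))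
      ∂μ.prod stdGaussian), ← h0, ← integral_sub hi hi0, ← integral_div]
    congr 1
    ext p
    ring
  simp_rw [hcenter]
  suffices h : Tendsto (fun σ => ∫ p : ℝ × ℝ, p.2 * ((signedPow q (η (p.1 + σ * p.2) (χ σ))
      - signedPow q (η p.1 (χ σ))) / σ ^ (q - 1)) ∂μ.prod stdGaussian)
      (nhdsWithin 0 (Ioi 0)) (nhds (∫ _ : ℝ × ℝ, (0 : ℝ) ∂μ.prod stdGaussian)) by
    simpa only [integral_zero] using h
  refine tendsto_integral_filter_of_dominated_convergence (fun p => 2 * |p.2| ^ q)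
    (Eventually.of_forall fun σ => ?_) ?_
    (((integrable_abs_rpow integrable_sq_stdGaussian (by linarith) hq2.le).comp_snd μ).const_mul 2)
    ?_
  · refine Continuous.aestronglyMeasurable ?_
    have h1 := continuous_signedPow_prox hη hq1 hq2 (hχ0 σ) σ
    have h2 := continuous_signedPow_prox hη hq1 hq2 (hχ0 σ) 0
    simp only [zero_mul, add_zero] at h2
    exact continuous_snd.mul ((h1.sub h2).div_const _)
  · filter_upwards [self_mem_nhdsWithin] with σ hσ
    refine ae_of_all _ fun p => ?_
    have hσ' : 0 < σ ^ (q - 1) := Real.rpow_pos_of_pos hσ _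
    have hL := abs_prox_sub_le hη hq1 (hχ0 σ) (p.1 + σ * p.2) p.1
    rw [add_sub_cancel_left, abs_mul σ, abs_of_pos (show 0 < σ from hσ)] at hL
    have hH := (abs_signedPow_sub_le hq1 hq2 (η (p.1 + σ * p.2) (χ σ)) (η p.1 (χ σ))).trans
      (mul_le_mul_of_nonneg_left (Real.rpow_le_rpow (abs_nonneg _) hL (by linarith : 0 ≤ q - 1))
        two_pos.le)
    rw [Real.mul_rpow (le_of_lt hσ) (abs_nonneg _)] at hH
    rw [Real.norm_eq_abs, abs_mul, abs_div, abs_of_pos hσ']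
    have hz : |p.2| ^ q = |p.2| * |p.2| ^ (q - 1) := by
      rw [← signedPow_mul_self hq1, ← abs_signedPow hq1, ← abs_mul, mul_comm, abs_of_nonneg]
      rw [mul_comm, signedPow_mul_self hq1]
      exact Real.rpow_nonneg (abs_nonneg _) _
    rw [hz]
    calc |p.2| * (|signedPow q (η (p.1 + σ * p.2) (χ σ)) - signedPow q (η p.1 (χ σ))|
          / σ ^ (q - 1)) ≤ |p.2| * (2 * |p.2| ^ (q - 1)) := by
          refine mul_le_mul_of_nonneg_left ?_ (abs_nonneg _)
          rw [div_le_iff₀ hσ']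
          linarith
      _ = 2 * (|p.2| * |p.2| ^ (q - 1)) := by ring
  · filter_upwards [ae_fst_ne_zero hμ0] with p hp
    have ht : Tendsto (fun σ => (η (p.1 + σ * p.2) (χ σ), η p.1 (χ σ)))
        (nhdsWithin 0 (Ioi 0)) (nhds (p.1, p.1)) :=
      (tendsto_prox hη hχ0 hq1 hχ p.1 p.2).prodMk_nhds
        (by simpa using tendsto_prox hη hχ0 hq1 hχ p.1 0)
    obtain ⟨K, hK⟩ := ((signedPow_isBigO_sub q hp).comp_tendsto ht).bound
    have hpow : Tendsto (fun σ : ℝ => |p.2| * (|K| * (|p.2| * σ ^ (2 - q))))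
        (nhdsWithin 0 (Ioi 0)) (nhds 0) := by
      have hid : Tendsto (fun σ : ℝ => σ) (nhdsWithin 0 (Ioi 0)) (nhds 0) :=
        tendsto_id.mono_left nhdsWithin_le_nhds
      have h2 := hid.rpow_const (p := 2 - q) (Or.inr (by linarith))
      rw [Real.zero_rpow (by linarith)] at h2
      simpa using ((h2.const_mul |p.2|).const_mul |K|).const_mul |p.2|
    refine squeeze_zero_norm' ?_ hpow
    filter_upwards [hK, self_mem_nhdsWithin] with σ hKσ hσ
    have hσ' : 0 < σ ^ (q - 1) := Real.rpow_pos_of_pos hσ _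
    have hL := abs_prox_sub_le hη hq1 (hχ0 σ) (p.1 + σ * p.2) p.1
    rw [add_sub_cancel_left, abs_mul σ, abs_of_pos (show 0 < σ from hσ)] at hL
    simp only [Function.comp, Real.norm_eq_abs] at hKσ
    rw [Real.norm_eq_abs, abs_mul, abs_div, abs_of_pos hσ']
    refine mul_le_mul_of_nonneg_left ?_ (abs_nonneg _)
    rw [div_le_iff₀ hσ']
    have hσ2 : σ ^ (2 - q) * σ ^ (q - 1) = σ := by
      rw [← Real.rpow_add hσ]
      norm_num
    have hK' : |signedPow q (η (p.1 + σ * p.2) (χ σ)) - signedPow q (η p.1 (χ σ))|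
        ≤ |K| * (σ * |p.2|) :=
      hKσ.trans ((mul_le_mul_of_nonneg_right (le_abs_self K) (abs_nonneg _)).trans
        (mul_le_mul_of_nonneg_left hL (abs_nonneg K)))
    calc _ ≤ |K| * (σ * |p.2|) := hK'
      _ = |K| * (|p.2| * σ ^ (2 - q)) * σ ^ (q - 1) := by
          linear_combination (-|K| * |p.2|) * hσ2
      _ = _ := by ring

include hη in
lemma mul_signedPow_prox_le (hq1 : 1 < q) {c σ : ℝ} (hc : 0 ≤ c) (hσ : 0 < σ) (z : ℝ) :
    |z * signedPow q (η (σ * z) c)| ≤ σ ^ (q - 1) * |z| ^ q := by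
  have h := abs_signedPow_le hq1 (abs_prox_le hη hq1 hc (σ * z))
  rw [signedPow_mul_of_pos hq1 hσ, abs_mul (σ ^ (q - 1)),
    abs_of_pos (Real.rpow_pos_of_pos hσ _)] at h
  rw [abs_mul]
  calc |z| * |signedPow q (η (σ * z) c)| ≤ |z| * (σ ^ (q - 1) * |signedPow q z|) :=
        mul_le_mul_of_nonneg_left h (abs_nonneg z)
    _ = σ ^ (q - 1) * |signedPow q z * z| := by
        rw [abs_mul]
        ring
    _ = _ := by
        rw [signedPow_mul_self hq1, abs_of_nonneg (Real.rpow_nonneg (abs_nonneg z) q)]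

include hη in
lemma integral_mul_signedPow_prox_le (hq1 : 1 < q) (hq2 : q < 2) {c σ : ℝ} (hc : 0 ≤ c)
    (hσ : 0 < σ) :
    ∫ z, z * signedPow q (η (σ * z) c) ∂stdGaussian
      ≤ σ ^ (q - 1) * ∫ z, |z| ^ q ∂stdGaussian := by
  have hi := (integrable_abs_rpow integrable_sq_stdGaussian (by linarith : 0 ≤ q)
    hq2.le).const_mul (σ ^ (q - 1))
  rw [← integral_const_mul]
  have hcont : Continuous fun z => z * signedPow q (η (σ * z) c) :=
    continuous_id.mul ((continuous_signedPow hq1 hq2).comp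
      ((continuous_prox hη hq1 hc).comp (by fun_prop)))
  exact integral_mono (hi.mono' hcont.aestronglyMeasurable
      (ae_of_all _ fun z => mul_signedPow_prox_le hη hq1 hc hσ z)) hi
    fun z => (le_abs_self _).trans (mul_signedPow_prox_le hη hq1 hc hσ z)

include hη in
lemma integral_signedPow_prox_sq_le (hq1 : 1 < q) (hq2 : q < 2) {c σ : ℝ} (hc : 0 ≤ c)
    (hσ : 0 < σ) :
    ∫ z, signedPow q (η (σ * z) c) ^ 2 ∂stdGaussian
      ≤ σ ^ (2 * q - 2) * ∫ z, |z| ^ (2 * q - 2) ∂stdGaussian := by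
  have hi := (integrable_abs_rpow integrable_sq_stdGaussian (by linarith : 0 ≤ 2 * q - 2)
    (by linarith)).const_mul (σ ^ (2 * q - 2))
  have hle : ∀ z, signedPow q (η (σ * z) c) ^ 2 ≤ σ ^ (2 * q - 2) * |z| ^ (2 * q - 2) := by
    intro z
    rw [← abs_of_pos hσ, ← Real.mul_rpow (abs_nonneg _) (abs_nonneg _), ← abs_mul,
      ← signedPow_sq hq1, abs_of_pos hσ]
    exact sq_le_sq.2 (abs_signedPow_le hq1 (abs_prox_le hη hq1 hc _))
  rw [← integral_const_mul]
  have hcont : Continuous fun z => signedPow q (η (σ * z) c) ^ 2 :=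
    ((continuous_signedPow hq1 hq2).comp
      ((continuous_prox hη hq1 hc).comp (by fun_prop))).pow 2
  refine integral_mono (hi.mono' hcont.aestronglyMeasurable (ae_of_all _ fun z => ?_)) hi hle
  rw [Real.norm_of_nonneg (sq_nonneg _)]
  exact hle z

include hη in
lemma tendsto_integral_mul_signedPow_prox_zero (hq1 : 1 < q) (hq2 : q < 2) {a : ℝ}
    (ha : 0 ≤ a) :
    Tendsto (fun σ => (∫ z, z * signedPow q (η (σ * z) (a * σ ^ q)) ∂stdGaussian) / σ ^ (q - 1))
      (nhdsWithin 0 (Ioi 0)) (nhds (∫ z, |z| ^ q ∂stdGaussian)) := by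
  simp_rw [← integral_div]
  have hid : Tendsto (fun σ : ℝ => σ) (nhdsWithin 0 (Ioi 0)) (nhds 0) :=
    tendsto_id.mono_left nhdsWithin_le_nhds
  refine tendsto_integral_filter_of_dominated_convergence (fun z => |z| ^ q) ?_ ?_
    (integrable_abs_rpow integrable_sq_stdGaussian (by linarith) hq2.le)
    (ae_of_all _ fun z => ?_)
  · filter_upwards [self_mem_nhdsWithin] with σ hσ
    have hc : 0 ≤ a * σ ^ q := mul_nonneg ha (Real.rpow_nonneg (le_of_lt hσ) _)
    exact ((continuous_id.mul ((continuous_signedPow hq1 hq2).comp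
      ((continuous_prox hη hq1 hc).comp (by fun_prop)))).div_const _).aestronglyMeasurable
  · filter_upwards [self_mem_nhdsWithin] with σ hσ
    have hc : 0 ≤ a * σ ^ q := mul_nonneg ha (Real.rpow_nonneg (le_of_lt hσ) _)
    have hσ' : 0 < σ ^ (q - 1) := Real.rpow_pos_of_pos hσ _
    refine ae_of_all _ fun z => ?_
    rw [Real.norm_eq_abs, abs_div, abs_of_pos hσ', div_le_iff₀ hσ', mul_comm (|z| ^ q)]
    exact mul_signedPow_prox_le hη hq1 hc hσ z
  · have hscale : Tendsto (fun σ => η (σ * z) (a * σ ^ q) / σ) (nhdsWithin 0 (Ioi 0))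
        (nhds z) := by
      have hpow : Tendsto (fun σ : ℝ => a * q * |z| ^ (q - 1) * σ ^ (2 * q - 2))
          (nhdsWithin 0 (Ioi 0)) (nhds 0) := by
        have h2 := hid.rpow_const (p := 2 * q - 2) (Or.inr (by linarith))
        rw [Real.zero_rpow (by linarith)] at h2
        simpa using h2.const_mul (a * q * |z| ^ (q - 1))
      have hdiff : Tendsto (fun σ => η (σ * z) (a * σ ^ q) / σ - z) (nhdsWithin 0 (Ioi 0))
          (nhds 0) := by
        refine squeeze_zero_norm' ?_ hpow
        filter_upwards [self_mem_nhdsWithin] with σ hσ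
        have hσ0 : 0 < σ := hσ
        have hc : 0 ≤ a * σ ^ q := mul_nonneg ha (Real.rpow_nonneg hσ0.le _)
        have h := abs_sub_prox_le hη hq1 hc (σ * z)
        rw [abs_mul σ, abs_of_pos hσ0, Real.mul_rpow hσ0.le (abs_nonneg z)] at h
        have heq : η (σ * z) (a * σ ^ q) / σ - z = -((σ * z - η (σ * z) (a * σ ^ q)) / σ) := by
          field_simp
          ring
        rw [heq, norm_neg, Real.norm_eq_abs, abs_div, abs_of_pos hσ0, div_le_iff₀ hσ0]
        refine h.trans_eq ?_
        have : σ ^ (2 * q - 2) * σ = σ ^ q * σ ^ (q - 1) := by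
          rw [← Real.rpow_add_one hσ0.ne', ← Real.rpow_add hσ0]
          ring_nf
        linear_combination (-(a * q * |z| ^ (q - 1))) * this
      simpa using hdiff.add_const z
    have h := (((continuous_signedPow hq1 hq2).tendsto z).comp hscale).const_mul z
    rw [mul_comm z, signedPow_mul_self hq1] at h
    refine h.congr' ?_
    filter_upwards [self_mem_nhdsWithin] with σ hσ
    have hσ0 : 0 < σ := hσ
    have hσ' : 0 < σ ^ (q - 1) := Real.rpow_pos_of_pos hσ0 _
    have h2 := signedPow_mul_of_pos hq1 hσ0 (η (σ * z) (a * σ ^ q) / σ)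
    rw [mul_div_cancel₀ _ hσ0.ne'] at h2
    rw [h2]
    simp only [Function.comp]
    field_simp

end Limits

section OptimalRisk

variable {q ε : ℝ} {η : ℝ → ℝ → ℝ} (hη : ∀ u χ, 0 ≤ χ → IsProx q χ u (η u χ))
  {μ : Measure ℝ} [IsProbabilityMeasure μ] (hμ : Integrable (fun x : ℝ => x ^ 2) μ)

lemma riskMin_le (η : ℝ → ℝ → ℝ) (ν : Measure ℝ) (σ : ℝ) {χ : ℝ} (hχ : 0 ≤ χ) :
    riskMin η ν σ ≤ ∫ b, (∫ z, (η (b + σ * z) χ - b) ^ 2 ∂stdGaussian) ∂ν :=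
  ciInf_le (f := fun χ : NNReal => ∫ b, (∫ z, (η (b + σ * z) (χ : ℝ) - b) ^ 2 ∂stdGaussian) ∂ν)
    ⟨0, by
      rintro _ ⟨χ, rfl⟩
      exact integral_nonneg fun b => integral_nonneg fun z => sq_nonneg _⟩ ⟨χ, hχ⟩

lemma riskMin_nonneg (η : ℝ → ℝ → ℝ) (ν : Measure ℝ) (σ : ℝ) : 0 ≤ riskMin η ν σ :=
  le_ciInf fun _ => integral_nonneg fun _ => integral_nonneg fun _ => sq_nonneg _

include hη hμ in
lemma risk_mix_eq (hq1 : 1 < q) (hq2 : q < 2) (hε0 : 0 ≤ ε) (hε1 : ε ≤ 1) {χ : ℝ}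
    (hχ : 0 ≤ χ) (σ : ℝ) :
    ∫ b, (∫ z, (η (b + σ * z) χ - b) ^ 2 ∂stdGaussian) ∂mix ε μ
      = σ ^ 2
        - 2 * q * χ * σ * ((1 - ε) * (∫ z, z * signedPow q (η (σ * z) χ) ∂stdGaussian)
          + ε * ∫ p : ℝ × ℝ, p.2 * signedPow q (η (p.1 + σ * p.2) χ) ∂μ.prod stdGaussian)
        + q ^ 2 * χ ^ 2 * ((1 - ε) * (∫ z, signedPow q (η (σ * z) χ) ^ 2 ∂stdGaussian)
          + ε * ∫ p : ℝ × ℝ, signedPow q (η (p.1 + σ * p.2) χ) ^ 2 ∂μ.prod stdGaussian) := by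
  rw [integral_mix_eq hη hμ hq1 hq2 hε0 hε1 hχ, integral_prox_sq hη hq1 hq2 hχ,
    integral_prox_error_sq hη hμ hq1 hq2 hχ]
  ring

include hη hμ in
lemma riskMin_le_sq (hq1 : 1 < q) (hq2 : q < 2) (hε0 : 0 ≤ ε) (hε1 : ε ≤ 1) (σ : ℝ) :
    riskMin η (mix ε μ) σ ≤ σ ^ 2 := by
  refine (riskMin_le η (mix ε μ) σ le_rfl).trans_eq ?_
  rw [risk_mix_eq hη hμ hq1 hq2 hε0 hε1 le_rfl]
  ring

include hη hμ in
lemma integral_prox_bias_sq_pos (hμ0 : μ {0} = 0) (hq1 : 1 < q) (hq2 : q < 2) {c : ℝ}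
    (hc : 0 < c) : 0 < ∫ p : ℝ × ℝ, (η p.1 c - p.1) ^ 2 ∂μ.prod stdGaussian := by
  have hi := integrable_prox_error_sq hη hμ hq1 hq2 hc.le 0
  simp only [zero_mul, add_zero] at hi
  refine (integral_nonneg fun _ => sq_nonneg _).lt_of_ne' fun h => ?_
  rw [integral_eq_zero_iff_of_nonneg (fun _ => sq_nonneg _) hi] at h
  obtain ⟨p, hp1, hp2⟩ := (h.and (ae_fst_ne_zero hμ0)).exists
  have hp : η p.1 c = p.1 := by
    simpa [sub_eq_zero] using hp1
  have h1 := (hη p.1 c hc.le).sub_eq hq1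
  rw [hp, sub_self] at h1
  have h2 : signedPow q p.1 = 0 := by
    have : c * q ≠ 0 := (mul_pos hc (by linarith)).ne'
    simpa [this] using h1.symm
  have h3 := abs_signedPow hq1 p.1
  rw [h2, abs_zero] at h3
  exact (Real.rpow_pos_of_pos (abs_pos.2 hp2) (q - 1)).ne h3

include hη hμ in
/-- Penalties whose risk vanishes as the noise level tends to `0` must themselves vanish. -/
lemma tendsto_penalty_zero (hμ0 : μ {0} = 0) (hq1 : 1 < q) (hq2 : q < 2) (hε0 : 0 < ε)
    (hε1 : ε ≤ 1) {χ : ℝ → ℝ} (hχ0 : ∀ σ, 0 ≤ χ σ)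
    (hrisk : Tendsto (fun σ => ∫ b, (∫ z, (η (b + σ * z) (χ σ) - b) ^ 2 ∂stdGaussian) ∂mix ε μ)
      (nhdsWithin 0 (Ioi 0)) (nhds 0)) :
    Tendsto χ (nhdsWithin 0 (Ioi 0)) (nhds 0) := by
  have hid : Tendsto (fun σ : ℝ => σ) (nhdsWithin 0 (Ioi 0)) (nhds 0) :=
    tendsto_id.mono_left nhdsWithin_le_nhds
  refine tendsto_order.2 ⟨fun c hc => Eventually.of_forall fun σ => hc.trans_le (hχ0 σ),
    fun c hc => ?_⟩
  have hK := integral_prox_bias_sq_pos hη hμ hμ0 hq1 hq2 hc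
  have hlim : Tendsto (fun σ => 2 *
      (∫ b, (∫ z, (η (b + σ * z) (χ σ) - b) ^ 2 ∂stdGaussian) ∂mix ε μ) / ε + 2 * σ ^ 2)
      (nhdsWithin 0 (Ioi 0)) (nhds 0) := by
    simpa using ((hrisk.const_mul 2).div_const ε).add ((hid.pow 2).const_mul 2)
  filter_upwards [hlim.eventually (gt_mem_nhds hK)] with σ hσ
  by_contra! hcχ
  refine hσ.not_ge ?_
  have hiR := integrable_prox_error_sq hη hμ hq1 hq2 (hχ0 σ) σ
  have hic := integrable_prox_error_sq hη hμ hq1 hq2 hc.le 0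
  simp only [zero_mul, add_zero] at hic
  have hz := (integrable_sq_stdGaussian.comp_snd μ).const_mul (2 * σ ^ 2)
  have hle : ∫ p : ℝ × ℝ, (η p.1 c - p.1) ^ 2 ∂μ.prod stdGaussian
      ≤ 2 * (∫ p : ℝ × ℝ, (η (p.1 + σ * p.2) (χ σ) - p.1) ^ 2 ∂μ.prod stdGaussian)
        + 2 * σ ^ 2 := by
    calc _ ≤ ∫ p : ℝ × ℝ, 2 * (η (p.1 + σ * p.2) (χ σ) - p.1) ^ 2 + 2 * σ ^ 2 * p.2 ^ 2
          ∂μ.prod stdGaussian := by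
          refine integral_mono hic ((hiR.const_mul 2).add hz) fun p => ?_
          have h1 := sq_le_sq.2 (abs_sub_prox_mono hη hc.le hcχ p.1)
          have h2 := sq_le_sq.2 (abs_prox_sub_le hη hq1 (hχ0 σ) (p.1 + σ * p.2) p.1)
          simp only
          nlinarith [sq_nonneg ((η (p.1 + σ * p.2) (χ σ) - p.1)
            + (η (p.1 + σ * p.2) (χ σ) - η p.1 (χ σ)))]
      _ = _ := by
          rw [integral_add (hiR.const_mul 2) hz, integral_const_mul, integral_const_mul, integral_snd_sq,
            mul_one]
  refine hle.trans ?_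
  rw [integral_mix_eq hη hμ hq1 hq2 hε0.le hε1 (hχ0 σ)]
  have h0 : 0 ≤ (1 - ε) * ∫ z, η (σ * z) (χ σ) ^ 2 ∂stdGaussian :=
    mul_nonneg (by linarith) (integral_nonneg fun _ => sq_nonneg _)
  gcongr
  rw [le_div_iff₀ hε0]
  linarith

lemma integral_abs_rpow_pos (hμ : Integrable (fun x : ℝ => x ^ 2) μ) (hμ0 : μ {0} = 0)
    {p : ℝ} (hp0 : 0 ≤ p) (hp2 : p ≤ 2) : 0 < ∫ x, |x| ^ p ∂μ := by
  refine (integral_nonneg fun _ => Real.rpow_nonneg (abs_nonneg _) _).lt_of_ne' fun h => ?_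
  rw [integral_eq_zero_iff_of_nonneg (fun _ => Real.rpow_nonneg (abs_nonneg _) _)
    (integrable_abs_rpow hμ hp0 hp2)] at h
  obtain ⟨b, hb1, hb2⟩ := (h.and (ae_ne_zero hμ0)).exists
  exact (Real.rpow_pos_of_pos (abs_pos.2 hb2) p).ne' hb1

include hη hμ in
/-- Upper bound on the optimal risk, from penalties of order `σ ^ q`. -/
lemma tendsto_risk_of_penalty (hμ0 : μ {0} = 0) (hq1 : 1 < q) (hq2 : q < 2) (hε0 : 0 < ε)
    (hε1 : ε ≤ 1) {a : ℝ} (ha : 0 ≤ a) :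
    Tendsto (fun σ => ((∫ b, (∫ z, (η (b + σ * z) (a * |σ| ^ q) - b) ^ 2 ∂stdGaussian) ∂mix ε μ)
        - σ ^ 2) / σ ^ (2 * q)) (nhdsWithin 0 (Ioi 0))
      (nhds (-(2 * q * a * ((1 - ε) * ∫ z, |z| ^ q ∂stdGaussian))
        + q ^ 2 * a ^ 2 * (ε * ∫ x, |x| ^ (2 * q - 2) ∂μ))) := by
  have hid : Tendsto (fun σ : ℝ => σ) (nhdsWithin 0 (Ioi 0)) (nhds 0) :=
    tendsto_id.mono_left nhdsWithin_le_nhds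
  have hχ0 : ∀ σ : ℝ, 0 ≤ a * |σ| ^ q := fun σ =>
    mul_nonneg ha (Real.rpow_nonneg (abs_nonneg σ) q)
  have hχ : Tendsto (fun σ : ℝ => a * |σ| ^ q) (nhdsWithin 0 (Ioi 0)) (nhds 0) := by
    have h2 := hid.abs.rpow_const (p := q) (Or.inr (by linarith))
    rw [abs_zero, Real.zero_rpow (by linarith)] at h2
    simpa using h2.const_mul a
  have hS := tendsto_integral_signedPow_prox_sq hη hμ hχ0 hq1 hq2 hχ
  have hT := tendsto_integral_mul_signedPow_prox hη hμ hχ0 hμ0 hq1 hq2 hχ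
  have hT0 : Tendsto (fun σ => (∫ z, z * signedPow q (η (σ * z) (a * |σ| ^ q)) ∂stdGaussian)
      / σ ^ (q - 1)) (nhdsWithin 0 (Ioi 0)) (nhds (∫ z, |z| ^ q ∂stdGaussian)) := by
    refine (tendsto_integral_mul_signedPow_prox_zero hη hq1 hq2 ha).congr' ?_
    filter_upwards [self_mem_nhdsWithin] with σ hσ
    rw [abs_of_pos (show 0 < σ from hσ)]
  have hS0 : Tendsto (fun σ => ∫ z, signedPow q (η (σ * z) (a * |σ| ^ q)) ^ 2 ∂stdGaussian)
      (nhdsWithin 0 (Ioi 0)) (nhds 0) := by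
    have h2 := hid.rpow_const (p := 2 * q - 2) (Or.inr (by linarith))
    rw [Real.zero_rpow (by linarith)] at h2
    have h3 := h2.mul_const (∫ z, |z| ^ (2 * q - 2) ∂stdGaussian)
    rw [zero_mul] at h3
    refine tendsto_of_tendsto_of_tendsto_of_le_of_le' tendsto_const_nhds h3
      (Eventually.of_forall fun σ => integral_nonneg fun _ => sq_nonneg _) ?_
    filter_upwards [self_mem_nhdsWithin] with σ hσ
    exact integral_signedPow_prox_sq_le hη hq1 hq2 (hχ0 σ) hσ
  have hmain := (((hT0.const_mul (1 - ε)).add (hT.const_mul ε)).const_mul (2 * q * a)).neg.add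
    (((hS0.const_mul (1 - ε)).add (hS.const_mul ε)).const_mul (q ^ 2 * a ^ 2))
  rw [mul_zero, mul_zero, add_zero, zero_add] at hmain
  refine hmain.congr' ?_
  filter_upwards [self_mem_nhdsWithin] with σ hσ
  have hσ0 : 0 < σ := hσ
  rw [risk_mix_eq hη hμ hq1 hq2 hε0.le hε1 (hχ0 σ)]
  have hA : σ ^ (q - 1) ≠ 0 := (Real.rpow_pos_of_pos hσ0 _).ne'
  have hq' : |σ| ^ q = σ ^ (q - 1) * σ := by
    rw [abs_of_pos hσ0, ← Real.rpow_add_one hσ0.ne', sub_add_cancel]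
  have h2q : σ ^ (2 * q) = (σ ^ (q - 1) * σ) ^ 2 := by
    rw [← hq', abs_of_pos hσ0, ← Real.rpow_mul_natCast hσ0.le, mul_comm]
    rfl
  rw [h2q, eq_div_iff (by positivity)]
  generalize (∫ z, z * signedPow q (η (σ * z) (a * |σ| ^ q)) ∂stdGaussian) = T0
  generalize (∫ z, signedPow q (η (σ * z) (a * |σ| ^ q)) ^ 2 ∂stdGaussian) = S0
  generalize (∫ p : ℝ × ℝ, p.2 * signedPow q (η (p.1 + σ * p.2) (a * |σ| ^ q))
    ∂μ.prod stdGaussian) = T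
  generalize (∫ p : ℝ × ℝ, signedPow q (η (p.1 + σ * p.2) (a * |σ| ^ q)) ^ 2
    ∂μ.prod stdGaussian) = S
  rw [hq']
  field_simp
  ring

include hη hμ in
/-- Second-order expansion of the optimal risk in the noise level `σ`. -/
lemma tendsto_riskMin (hμ0 : μ {0} = 0) (hq1 : 1 < q) (hq2 : q < 2) (hε0 : 0 < ε)
    (hε1 : ε ≤ 1) :
    Tendsto (fun σ => (riskMin η (mix ε μ) σ - σ ^ 2) / σ ^ (2 * q)) (nhdsWithin 0 (Ioi 0))
      (nhds (-((1 - ε) ^ 2 * (∫ z, |z| ^ q ∂stdGaussian) ^ 2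
        / (ε * ∫ x, |x| ^ (2 * q - 2) ∂μ)))) := by
  have hid : Tendsto (fun σ : ℝ => σ) (nhdsWithin 0 (Ioi 0)) (nhds 0) :=
    tendsto_id.mono_left nhdsWithin_le_nhds
  have hM := integral_abs_rpow_pos hμ hμ0 (by linarith : 0 ≤ 2 * q - 2) (by linarith)
  have hm : 0 ≤ ∫ z, |z| ^ q ∂stdGaussian :=
    integral_nonneg fun _ => Real.rpow_nonneg (abs_nonneg _) _
  set M := ∫ x, |x| ^ (2 * q - 2) ∂μ with hMdef
  set m := ∫ z, |z| ^ q ∂stdGaussian with hmdef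
  have hε1' : 0 ≤ 1 - ε := by linarith
  have hq0 : 0 < q := by linarith
  have hchoice : ∀ σ : ℝ, ∃ c : ℝ, 0 ≤ c ∧ (0 < σ →
      ∫ b, (∫ z, (η (b + σ * z) c - b) ^ 2 ∂stdGaussian) ∂mix ε μ
        < riskMin η (mix ε μ) σ + σ ^ (2 * q) * σ) := by
    intro σ
    by_cases hσ : 0 < σ
    · have hpos : 0 < σ ^ (2 * q) * σ := mul_pos (Real.rpow_pos_of_pos hσ _) hσ
      obtain ⟨c, hc⟩ := exists_lt_of_ciInf_lt (lt_add_of_pos_right (riskMin η (mix ε μ) σ) hpos)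
      exact ⟨c, c.2, fun _ => hc⟩
    · exact ⟨0, le_rfl, fun h => absurd h hσ⟩
  choose χ hχ0 hχr using hchoice
  have hχ : Tendsto χ (nhdsWithin 0 (Ioi 0)) (nhds 0) := by
    refine tendsto_penalty_zero hη hμ hμ0 hq1 hq2 hε0 hε1 hχ0 ?_
    have h2 := hid.rpow_const (p := 2 * q) (Or.inr (by linarith))
    rw [Real.zero_rpow (by linarith)] at h2
    have hup : Tendsto (fun σ : ℝ => σ ^ 2 + σ ^ (2 * q) * σ) (nhdsWithin 0 (Ioi 0))
        (nhds 0) := by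
      simpa using (hid.pow 2).add (h2.mul hid)
    refine tendsto_of_tendsto_of_tendsto_of_le_of_le' tendsto_const_nhds hup
      (Eventually.of_forall fun σ => integral_nonneg fun _ => integral_nonneg fun _ =>
        sq_nonneg _) ?_
    filter_upwards [self_mem_nhdsWithin] with σ hσ
    have := riskMin_le_sq hη hμ hq1 hq2 hε0.le hε1 σ
    linarith [hχr σ hσ]
  have hS := tendsto_integral_signedPow_prox_sq hη hμ hχ0 hq1 hq2 hχ
  have hT := tendsto_integral_mul_signedPow_prox hη hμ hχ0 hμ0 hq1 hq2 hχ
  rw [← hMdef] at hS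
  have hlow : Tendsto (fun σ => -(((1 - ε) * m + ε *
      ((∫ p : ℝ × ℝ, p.2 * signedPow q (η (p.1 + σ * p.2) (χ σ)) ∂μ.prod stdGaussian)
        / σ ^ (q - 1))) ^ 2 / (ε *
      ∫ p : ℝ × ℝ, signedPow q (η (p.1 + σ * p.2) (χ σ)) ^ 2 ∂μ.prod stdGaussian)) - σ)
      (nhdsWithin 0 (Ioi 0)) (nhds (-((1 - ε) ^ 2 * m ^ 2 / (ε * M)))) := by
    have h := ((((hT.const_mul ε).const_add ((1 - ε) * m)).pow 2).div (hS.const_mul ε)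
      (mul_pos hε0 hM).ne').neg.sub hid
    simpa [mul_pow] using h
  have ha : 0 ≤ (1 - ε) * m / (ε * q * M) := by positivity
  have hupp := tendsto_risk_of_penalty hη hμ hμ0 hq1 hq2 hε0 hε1 ha
  rw [← hmdef, ← hMdef] at hupp
  have hval : -(2 * q * ((1 - ε) * m / (ε * q * M)) * ((1 - ε) * m))
      + q ^ 2 * ((1 - ε) * m / (ε * q * M)) ^ 2 * (ε * M)
      = -((1 - ε) ^ 2 * m ^ 2 / (ε * M)) := by
    field_simp
    ring
  rw [hval] at hupp
  refine tendsto_of_tendsto_of_tendsto_of_le_of_le' hlow hupp ?_ ?_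
  · filter_upwards [self_mem_nhdsWithin, hS.eventually (lt_mem_nhds hM)] with σ hσ hSσ
    have hσ0 : 0 < σ := hσ
    have hr := hχr σ hσ0
    rw [risk_mix_eq hη hμ hq1 hq2 hε0.le hε1 (hχ0 σ)] at hr
    have hT0 := integral_mul_signedPow_prox_le hη hq1 hq2 (hχ0 σ) hσ0
    rw [← hmdef] at hT0
    have hS0 : 0 ≤ ∫ z, signedPow q (η (σ * z) (χ σ)) ^ 2 ∂stdGaussian :=
      integral_nonneg fun _ => sq_nonneg _
    have hA : 0 < σ ^ (q - 1) := Real.rpow_pos_of_pos hσ0 _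
    have h2q : σ ^ (2 * q) = (σ ^ (q - 1) * σ) ^ 2 := by
      rw [← Real.rpow_add_one hσ0.ne', sub_add_cancel, ← Real.rpow_mul_natCast hσ0.le, mul_comm]
      rfl
    rw [h2q] at hr ⊢
    have hc := hχ0 σ
    revert hr hT0 hS0 hSσ hc
    generalize (∫ z, z * signedPow q (η (σ * z) (χ σ)) ∂stdGaussian) = T0
    generalize (∫ z, signedPow q (η (σ * z) (χ σ)) ^ 2 ∂stdGaussian) = S0
    generalize (∫ p : ℝ × ℝ, p.2 * signedPow q (η (p.1 + σ * p.2) (χ σ))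
      ∂μ.prod stdGaussian) = T
    generalize (∫ p : ℝ × ℝ, signedPow q (η (p.1 + σ * p.2) (χ σ)) ^ 2
      ∂μ.prod stdGaussian) = S
    generalize χ σ = c
    generalize σ ^ (q - 1) = A at hA ⊢
    intro hS' hr hT0 hS0 hc
    rw [le_div_iff₀ (by positivity)]
    obtain ⟨t, rfl⟩ : ∃ t, T = A * t := ⟨T / A, by field_simp⟩
    rw [mul_div_cancel_left₀ t hA.ne']
    have e1 : q * c * σ * ((1 - ε) * T0) ≤ q * c * σ * ((1 - ε) * (A * m)) := by gcongr
    have e2 : 0 ≤ q ^ 2 * c ^ 2 * ((1 - ε) * S0) := by positivity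
    have e3 : 0 ≤ (q * c * (ε * S) - A * σ * ((1 - ε) * m + ε * t)) ^ 2 / (ε * S) := by
      positivity
    have e4 : (q * c * (ε * S) - A * σ * ((1 - ε) * m + ε * t)) ^ 2 / (ε * S)
        = q ^ 2 * c ^ 2 * (ε * S) - 2 * (q * c * σ * (A * ((1 - ε) * m + ε * t)))
          + ((1 - ε) * m + ε * t) ^ 2 / (ε * S) * (A * σ) ^ 2 := by
      field_simp
      ring
    linarith
  · filter_upwards [self_mem_nhdsWithin] with σ hσ
    have hσ0 : 0 < σ := hσ
    have := riskMin_le η (mix ε μ) σ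
      (mul_nonneg ha (Real.rpow_nonneg (abs_nonneg σ) q))
    have hp : 0 < σ ^ (2 * q) := Real.rpow_pos_of_pos hσ0 _
    gcongr

end OptimalRisk

/-- Second-order small-error expansion of the optimally-tuned AMSE for `q ∈ (1,2)`, `δ > 1`:
`AMSE(σ_w) = σ_w²/(1−1/δ) − [δ^{q+1}(1−ε)²(E|Z|^q)²/((δ−1)^{q+1} ε E|G|^{2q−2})]·σ_w^{2q}
  + o(σ_w^{2q})` as `σ_w → 0⁺`. Here `σb σ_w` is the unique positive solution `σ̄` of
`σ̄² = σ_w² + (1/δ)·min_{χ≥0}E[(η_q(B+σ̄Z;χ)−B)²]` and `AMSE(σ_w) = riskMin η (mix ε g) (σb σ_w)`. -/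
theorem amse_expansion_q_between_one_two
    (q δ ε : ℝ) (hq1 : 1 < q) (hq2 : q < 2) (hδ : 1 < δ) (hε : ε ∈ Ioo (0:ℝ) 1)
    (g : Measure ℝ) [IsProbabilityMeasure g] (hg0 : g {0} = 0)
    (hG2 : Integrable (fun x => x^2) g)
    (hGsmall : (fun t => (g {x : ℝ | |x| ≤ t}).toReal)
      =O[nhdsWithin (0:ℝ) (Ioi 0)] (fun t => t))
    (η : ℝ → ℝ → ℝ) (hη : ∀ u χ, 0 ≤ χ → IsProx q χ u (η u χ))
    (σb : ℝ → ℝ)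
    (hσb : ∀ s, 0 < s → 0 < σb s ∧
      (σb s) ^ 2 = s ^ 2 + (1/δ) * riskMin η (mix ε g) (σb s)) :
    (fun s => riskMin η (mix ε g) (σb s) -
        (s ^ 2 / (1 - 1/δ) -
          (δ ^ (q+1) * (1 - ε)^2 * (∫ z, |z| ^ q ∂stdGaussian)^2 /
            ((δ - 1) ^ (q+1) * ε * ∫ x, |x| ^ (2*q - 2) ∂g)) * s ^ (2*q)))
      =o[nhdsWithin (0:ℝ) (Ioi 0)] (fun s => s ^ (2*q)) := by
  obtain ⟨hε0, hε1⟩ := hε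
  have hlim := tendsto_riskMin hη hG2 hg0 hq1 hq2 hε0 hε1.le
  set M := ∫ x, |x| ^ (2 * q - 2) ∂g with hM
  set m := ∫ z, |z| ^ q ∂stdGaussian with hm
  set C := (1 - ε) ^ 2 * m ^ 2 / (ε * M) with hC
  have hδ0 : 0 < δ := by linarith
  have hδ1 : 0 < δ - 1 := by linarith
  have hid : Tendsto (fun s : ℝ => s) (nhdsWithin 0 (Ioi 0)) (nhds 0) :=
    tendsto_id.mono_left nhdsWithin_le_nhds
  have hfix : ∀ s, 0 < s → δ * (σb s) ^ 2 = δ * s ^ 2 + riskMin η (mix ε g) (σb s) := by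
    intro s hs
    rw [(hσb s hs).2, mul_add, ← mul_assoc, mul_one_div_cancel hδ0.ne', one_mul]
  have hsq : ∀ s, 0 < s → (σb s) ^ 2 ≤ δ / (δ - 1) * s ^ 2 := by
    intro s hs
    have h2 := riskMin_le_sq hη hG2 hq1 hq2 hε0.le hε1.le (σb s)
    have h3 := hfix s hs
    rw [div_mul_eq_mul_div, le_div_iff₀ hδ1]
    linarith
  have hσ0 : Tendsto σb (nhdsWithin 0 (Ioi 0)) (nhdsWithin 0 (Ioi 0)) := by
    refine tendsto_nhdsWithin_iff.2 ⟨?_, ?_⟩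
    · have hup : Tendsto (fun s : ℝ => √(δ / (δ - 1) * s ^ 2)) (nhdsWithin 0 (Ioi 0))
          (nhds 0) := by
        simpa using ((hid.pow 2).const_mul (δ / (δ - 1))).sqrt
      refine squeeze_zero_norm' ?_ hup
      filter_upwards [self_mem_nhdsWithin] with s hs
      exact Real.abs_le_sqrt (hsq s hs)
    · filter_upwards [self_mem_nhdsWithin] with s hs
      exact (hσb s hs).1
  have hh := hlim.comp hσ0
  have hr : Tendsto (fun s => (σb s) ^ 2 / s ^ 2) (nhdsWithin 0 (Ioi 0))
      (nhds (δ / (δ - 1))) := by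
    have hpow : Tendsto (fun s => (σb s) ^ (2 * q - 2)) (nhdsWithin 0 (Ioi 0)) (nhds 0) := by
      have h2 := (hσ0.mono_right nhdsWithin_le_nhds).rpow_const (p := 2 * q - 2)
        (Or.inr (by linarith))
      rwa [Real.zero_rpow (by linarith)] at h2
    have h := (((hh.mul hpow).const_sub (δ - 1)).inv₀ (by simpa using hδ1.ne')).const_mul δ
    rw [mul_zero, sub_zero, ← div_eq_mul_inv] at h
    refine h.congr' ?_
    have hne : ∀ᶠ s in nhdsWithin (0 : ℝ) (Ioi 0), 0 < δ - 1 -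
        ((fun σ => (riskMin η (mix ε g) σ - σ ^ 2) / σ ^ (2 * q)) ∘ σb) s
          * (σb s) ^ (2 * q - 2) := by
      have h' := (hh.mul hpow).const_sub (δ - 1)
      rw [mul_zero, sub_zero] at h'
      exact h'.eventually (lt_mem_nhds hδ1)
    filter_upwards [self_mem_nhdsWithin, hne] with s hs hnes
    have hpos := (hσb s hs).1
    have hs0 : s ≠ 0 := ne_of_gt hs
    have hp2 : (σb s) ^ (2 * q) = (σb s) ^ (2 * q - 2) * (σb s) ^ 2 := by
      rw [← Real.rpow_natCast (σb s) 2, ← Real.rpow_add hpos]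
      norm_num
    have hpp : 0 < (σb s) ^ (2 * q - 2) := Real.rpow_pos_of_pos hpos _
    have heq' := hfix s hs
    rw [← div_eq_mul_inv, div_eq_div_iff hnes.ne' (pow_ne_zero 2 hs0)]
    simp only [Function.comp, hp2]
    field_simp
    linarith
  have hlim2 : Tendsto (fun s => δ / (δ - 1) *
      (((fun σ => (riskMin η (mix ε g) σ - σ ^ 2) / σ ^ (2 * q)) ∘ σb) s *
        ((σb s) ^ 2 / s ^ 2) ^ q)) (nhdsWithin 0 (Ioi 0))
      (nhds (δ / (δ - 1) * (-C * (δ / (δ - 1)) ^ q))) :=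
    (hh.mul (hr.rpow_const (Or.inr (by linarith)))).const_mul _
  rw [isLittleO_iff_tendsto' (by
    filter_upwards [self_mem_nhdsWithin] with s hs h
    exact absurd h (Real.rpow_pos_of_pos hs _).ne')]
  have hconst : δ ^ (q + 1) * (1 - ε) ^ 2 * m ^ 2 / ((δ - 1) ^ (q + 1) * ε * M)
      = -(δ / (δ - 1) * (-C * (δ / (δ - 1)) ^ q)) := by
    rw [Real.div_rpow hδ0.le hδ1.le, Real.rpow_add_one hδ0.ne', Real.rpow_add_one hδ1.ne', hC]
    have h1 := (Real.rpow_pos_of_pos hδ1 q).ne'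
    simp only [mul_neg, neg_mul, neg_neg, div_mul_div_comm]
    congr 1 <;> ring
  have hfin := hlim2.sub_const (δ / (δ - 1) * (-C * (δ / (δ - 1)) ^ q))
  rw [sub_self] at hfin
  refine hfin.congr' ?_
  filter_upwards [self_mem_nhdsWithin] with s hs
  have hpos := (hσb s hs).1
  have hs0 : 0 < s := hs
  have heq' := hfix s hs
  have hpow : ∀ {x : ℝ}, 0 < x → (x ^ 2) ^ q = x ^ (2 * q) := by
    intro x hx
    rw [← Real.rpow_natCast x 2, ← Real.rpow_mul hx.le]
    norm_num
  rw [hconst, Real.div_rpow (sq_nonneg _) (sq_nonneg _), hpow hpos, hpow hs0]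
  have h1 : 0 < (σb s) ^ (2 * q) := Real.rpow_pos_of_pos hpos _
  have h2 : 0 < s ^ (2 * q) := Real.rpow_pos_of_pos hs0 _
  have h3 : s ^ 2 / (1 - 1 / δ) = δ / (δ - 1) * s ^ 2 := by
    field_simp
  have h4 : riskMin η (mix ε g) (σb s) - δ / (δ - 1) * s ^ 2
      = δ / (δ - 1) * (riskMin η (mix ε g) (σb s) - (σb s) ^ 2) := by
    field_simp
    linarith
  rw [h3, eq_div_iff h2.ne', sub_sub_eq_add_sub, add_sub_right_comm, h4]
  simp only [Function.comp]
  field_simp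
  ring
end
end
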